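/- arXiv:1908.06480 — 8 statements merged into one kernel-verified Lean document; each statement's English description precedes it below -/
import Mathlib

section
/- For every ε > 0 there exists a positive integer n₀ such that every oriented graph G on n ≥ n₀ vertices satisfies t(G) + i(G) ≥ 1/9 − ε. -/
open scoped Classical

/-- An oriented graph: a directed graph with no loops and no pair of
antiparallel edges, given by an asymmetric (hence irreflexive) adjacency
relation. -/
structure OrientedGraph (V : Type) [Fintype V] [DecidableEq V] where
  adj : V → V → Prop
  asymm : ∀ u v : V, adj u v → ¬ adj v u

namespace OrientedGraph

variable {V : Type} [Fintype V] [DecidableEq V]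

/-- A 3-element vertex set spans a transitive triangle: its vertices are
pairwise adjacent and the induced orientation is acyclic. -/
def isTransTriangle (G : OrientedGraph V) (s : Finset V) : Prop :=
  ∃ x y z : V, s = {x, y, z} ∧ G.adj x y ∧ G.adj y z ∧ G.adj x z

/-- A vertex set is independent: no two of its vertices are adjacent. -/
def isIndep (G : OrientedGraph V) (s : Finset V) : Prop :=
  ∀ x ∈ s, ∀ y ∈ s, ¬ G.adj x y

/-- `T₃(G)`: the number of 3-element vertex sets spanning a transitive triangle. -/
noncomputable def T3 (G : OrientedGraph V) : ℕ :=
  ((Finset.univ.powersetCard 3 : Finset (Finset V)).filter G.isTransTriangle).card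

/-- `I₃(G)`: the number of 3-element vertex sets that are independent. -/
noncomputable def I3 (G : OrientedGraph V) : ℕ :=
  ((Finset.univ.powersetCard 3 : Finset (Finset V)).filter G.isIndep).card

/-- `t(G) = T₃(G)/C(n,3)`. -/
noncomputable def tDens (G : OrientedGraph V) : ℝ :=
  (G.T3 : ℝ) / ((Fintype.card V).choose 3 : ℝ)

/-- `i(G) = I₃(G)/C(n,3)`. -/
noncomputable def iDens (G : OrientedGraph V) : ℝ :=
  (G.I3 : ℝ) / ((Fintype.card V).choose 3 : ℝ)

end OrientedGraph

namespace OrientedGraph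

/-- The relation between two vertices: `1` for an out-edge, `2 = -1` for an in-edge, `0` for a
non-adjacent pair. -/
noncomputable def rel {V : Type} [Fintype V] [DecidableEq V] (G : OrientedGraph V) (x y : V) :
    Fin 3 :=
  if G.adj x y then 1 else if G.adj y x then 2 else 0

/-- Indicator of a transitive triangle on `x, y, z`, in terms of the relations of `xy`, `xz`,
`yz`. -/
def transInd : Fin 3 → Fin 3 → Fin 3 → ℤ
  | 1, 1, 1 => 1
  | 1, 1, 2 => 1
  | 1, 2, 2 => 1
  | 2, 2, 2 => 1
  | 2, 2, 1 => 1
  | 2, 1, 1 => 1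
  | _, _, _ => 0

/-- Indicator of an independent triple. -/
def indepInd : Fin 3 → Fin 3 → Fin 3 → ℤ
  | 0, 0, 0 => 1
  | _, _, _ => 0

/-! The linear forms of the sum-of-squares certificate. The arguments are the relations of
`xy`, `xw`, `yw`; the pair `xy` is the type, and `w` is the vertex summed over. The first four
forms are supported on non-adjacent pairs, the last four on edges from `x` to `y`. -/

/-- Excess of common non-neighbours over vertices dominating or dominated by the non-edge. -/
def formIndep : Fin 3 → Fin 3 → Fin 3 → ℤ
  | 0, 0, 0 => 2
  | 0, 1, 1 => -1
  | 0, 2, 2 => -1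
  | _, _, _ => 0

/-- Imbalance of out- and in-neighbours of a non-edge. -/
def formImbalance : Fin 3 → Fin 3 → Fin 3 → ℤ
  | 0, 1, 1 => 4
  | 0, 2, 2 => -4
  | 0, 0, 1 => 3
  | 0, 1, 0 => 3
  | 0, 0, 2 => -3
  | 0, 2, 0 => -3
  | _, _, _ => 0

/-- Imbalance of out- and in-neighbours attached to one end of a non-edge. -/
def formOneSided : Fin 3 → Fin 3 → Fin 3 → ℤ
  | 0, 0, 1 => 1
  | 0, 1, 0 => 1
  | 0, 0, 2 => -1
  | 0, 2, 0 => -1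
  | _, _, _ => 0

/-- Difference of the numbers of private neighbours of the ends of a non-edge. -/
def formPrivate : Fin 3 → Fin 3 → Fin 3 → ℤ
  | 0, 0, 1 => 1
  | 0, 1, 0 => -1
  | 0, 0, 2 => 1
  | 0, 2, 0 => -1
  | _, _, _ => 0

/-- Twins of the tail minus twins of the head of an edge. -/
def formTwin : Fin 3 → Fin 3 → Fin 3 → ℤ
  | 1, 0, 2 => 1
  | 1, 1, 0 => -1
  | _, _, _ => 0

/-- Imbalance of the two kinds of induced paths through an edge. -/
def formPath : Fin 3 → Fin 3 → Fin 3 → ℤ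
  | 1, 0, 1 => 1
  | 1, 2, 0 => -1
  | _, _, _ => 0

/-- Common out- or in-neighbours of an edge against its common non-neighbours. -/
def formDominated : Fin 3 → Fin 3 → Fin 3 → ℤ
  | 1, 1, 1 => 3
  | 1, 2, 2 => 3
  | 1, 0, 0 => -2
  | _, _, _ => 0

/-- Induced paths through an edge against its common non-neighbours. -/
def formPathIndep : Fin 3 → Fin 3 → Fin 3 → ℤ
  | 1, 0, 1 => 3
  | 1, 2, 0 => 3
  | 1, 0, 0 => -2
  | _, _, _ => 0

/-- The positive semidefinite kernel built from the linear forms. -/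
def kernel (r s t s' t' : Fin 3) : ℤ :=
  24 * (formIndep r s t * formIndep r s' t') +
  6 * (formImbalance r s t * formImbalance r s' t') +
  27 * (formOneSided r s t * formOneSided r s' t') +
  57 * (formPrivate r s t * formPrivate r s' t') +
  156 * (formTwin r s t * formTwin r s' t') +
  156 * (formPath r s t * formPath r s' t') +
  28 * (formDominated r s t * formDominated r s' t') +
  8 * (formPathIndep r s t * formPathIndep r s' t')

/-- Indicator of a transitive triangle or an independent triple. -/
def monoInd (r s t : Fin 3) : ℤ := transInd r s t + indepInd r s t

/-- The pointwise inequality: over all orderings of four vertices with pairwise relations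
`a, b, c, d, e, f` (for `01, 02, 03, 12, 13, 23`), the objective dominates the kernel. -/
theorem kernel_le_monoInd : ∀ a b c d e f : Fin 3,
    kernel a b d c e + kernel (-a) d b e c +
    kernel b a (-d) c f + kernel (-b) (-d) a f c +
    kernel c a (-e) b (-f) + kernel (-c) (-e) a (-f) b +
    kernel d (-a) (-b) e f + kernel (-d) (-b) (-a) f e +
    kernel e (-a) (-c) d (-f) + kernel (-e) (-c) (-a) (-f) d +
    kernel f (-b) (-c) (-d) (-e) + kernel (-f) (-c) (-b) (-e) (-d) + 144 ≤
    324 * (monoInd a b d + monoInd a c e + monoInd b c f + monoInd d e f) := by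
  decide +kernel

section Sums

variable {V : Type} [Fintype V] [DecidableEq V]

theorem rel_swap (G : OrientedGraph V) (x y : V) : G.rel y x = -G.rel x y := by
  unfold rel
  have h := G.asymm x y
  split_ifs <;> first | rfl | tauto

theorem rel_eq_one (G : OrientedGraph V) (x y : V) : G.rel x y = 1 ↔ G.adj x y := by
  unfold rel
  split_ifs <;> simp_all

theorem rel_eq_two (G : OrientedGraph V) (x y : V) : G.rel x y = 2 ↔ G.adj y x := by
  unfold rel
  have h := G.asymm x y
  split_ifs <;> simp_all

theorem rel_eq_zero (G : OrientedGraph V) (x y : V) :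
    G.rel x y = 0 ↔ ¬ G.adj x y ∧ ¬ G.adj y x := by
  unfold rel
  split_ifs <;> simp_all

theorem sum_kernel_nonneg (G : OrientedGraph V) :
    0 ≤ ∑ x, ∑ y, ∑ z, ∑ w,
      kernel (G.rel x y) (G.rel x z) (G.rel y z) (G.rel x w) (G.rel y w) := by
  refine Finset.sum_nonneg fun x _ => Finset.sum_nonneg fun y _ => ?_
  simp only [kernel, Finset.sum_add_distrib]
  have h (c : ℤ) (hc : 0 ≤ c) (f : Fin 3 → Fin 3 → Fin 3 → ℤ) :
      0 ≤ ∑ z, ∑ w, c * (f (G.rel x y) (G.rel x z) (G.rel y z) *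
        f (G.rel x y) (G.rel x w) (G.rel y w)) := by
    simp only [← Finset.mul_sum, ← Finset.sum_mul]
    exact mul_nonneg hc (mul_self_nonneg _)
  linarith [h 24 (by norm_num) formIndep, h 6 (by norm_num) formImbalance,
    h 27 (by norm_num) formOneSided, h 57 (by norm_num) formPrivate, h 156 (by norm_num) formTwin,
    h 156 (by norm_num) formPath, h 28 (by norm_num) formDominated,
    h 8 (by norm_num) formPathIndep]

/-- Averaging a function of a type pair `xy` and two further vertices over the twelve choices of
the ordered pair among four vertices. -/
theorem sum_pair_orderings {V : Type} [Fintype V] (H : V → V → V → V → ℤ) :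
    ∑ x, ∑ y, ∑ z, ∑ w,
      (H x y z w + H y x z w + H x z y w + H z x y w + H x w y z + H w x y z +
        H y z x w + H z y x w + H y w x z + H w y x z + H z w x y + H w z x y) =
      12 * ∑ x, ∑ y, ∑ z, ∑ w, H x y z w := by
  have s12 (g : V → V → V → V → ℤ) :
      ∑ x, ∑ y, ∑ z, ∑ w, g y x z w = ∑ x, ∑ y, ∑ z, ∑ w, g x y z w := Finset.sum_comm
  have s23 (g : V → V → V → V → ℤ) :
      ∑ x, ∑ y, ∑ z, ∑ w, g x z y w = ∑ x, ∑ y, ∑ z, ∑ w, g x y z w :=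
    Finset.sum_congr rfl fun _ _ => Finset.sum_comm
  have s34 (g : V → V → V → V → ℤ) :
      ∑ x, ∑ y, ∑ z, ∑ w, g x y w z = ∑ x, ∑ y, ∑ z, ∑ w, g x y z w :=
    Finset.sum_congr rfl fun _ _ => Finset.sum_congr rfl fun _ _ => Finset.sum_comm
  have h1 := s12 H
  have h2 := s23 H
  have h3 := s23 fun x y z w => H y x z w
  have h4 := s34 fun x y z w => H x z y w
  have h5 := s34 fun x y z w => H z x y w
  have h6 := s12 fun x y z w => H x z y w
  have h7 := s12 fun x y z w => H z x y w
  have h8 := s12 fun x y z w => H x w y z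
  have h9 := s12 fun x y z w => H w x y z
  have h10 := s23 fun x y z w => H y w x z
  have h11 := s23 fun x y z w => H w y x z
  simp only [Finset.sum_add_distrib]
  linarith

theorem card_pow_three_le_sum_monoInd (G : OrientedGraph V) :
    (Fintype.card V : ℤ) ^ 3 ≤
      9 * ∑ x, ∑ y, ∑ z, monoInd (G.rel x y) (G.rel x z) (G.rel y z) := by
  set S := ∑ x, ∑ y, ∑ z, monoInd (G.rel x y) (G.rel x z) (G.rel y z) with hS
  rcases Nat.eq_zero_or_pos (Fintype.card V) with h0 | hpos
  · have : IsEmpty V := Fintype.card_eq_zero_iff.mp h0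
    simp [hS]
  have hsum := sum_pair_orderings fun x y z w =>
    kernel (G.rel x y) (G.rel x z) (G.rel y z) (G.rel x w) (G.rel y w)
  have hnonneg := G.sum_kernel_nonneg
  have hpt : ∑ x, ∑ y, ∑ z, ∑ w, (_ + 144 : ℤ) ≤ ∑ x, ∑ y, ∑ z, ∑ w, _ :=
    Finset.sum_le_sum fun x _ => Finset.sum_le_sum fun y _ => Finset.sum_le_sum fun z _ =>
      Finset.sum_le_sum fun w _ =>
        kernel_le_monoInd (G.rel x y) (G.rel x z) (G.rel x w) (G.rel y z) (G.rel y w) (G.rel z w)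
  simp only [← rel_swap] at hpt
  simp only [Finset.sum_add_distrib] at hpt hsum
  simp only [← Finset.mul_sum, Finset.sum_add_distrib, Finset.sum_const, Finset.card_univ,
    nsmul_eq_mul, ← hS] at hpt
  have hpos' : (0 : ℤ) < Fintype.card V := by exact_mod_cast hpos
  refine le_of_mul_le_mul_left ?_ hpos'
  linarith

theorem sum_ite_le_six_mul_card (P : Finset V → Prop) :
    ∑ x : V, ∑ y : V, ∑ z : V, (if x ≠ y ∧ x ≠ z ∧ y ≠ z ∧ P {x, y, z} then 1 else 0 : ℤ) ≤
      6 * ((Finset.univ.powersetCard 3 : Finset (Finset V)).filter P).card := by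
  have key := Finset.card_le_mul_card_image_of_maps_to
    (s := (Finset.univ : Finset (V × V × V)).filter fun p =>
      p.1 ≠ p.2.1 ∧ p.1 ≠ p.2.2 ∧ p.2.1 ≠ p.2.2 ∧ P {p.1, p.2.1, p.2.2})
    (t := (Finset.univ.powersetCard 3 : Finset (Finset V)).filter P)
    (f := fun p => {p.1, p.2.1, p.2.2}) ?_ 6 ?_
  · rw [Finset.card_filter, Fintype.sum_prod_type] at key
    simp only [Fintype.sum_prod_type] at key
    exact_mod_cast key
  · rintro ⟨x, y, z⟩ h
    simp only [Finset.mem_filter, Finset.mem_univ, true_and, Finset.mem_powersetCard,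
      Finset.subset_univ] at h ⊢
    exact ⟨Finset.card_eq_three.mpr ⟨x, y, z, h.1, h.2.1, h.2.2.1, rfl⟩, h.2.2.2⟩
  · intro b hb
    simp only [Finset.mem_filter, Finset.mem_powersetCard, Finset.subset_univ, true_and] at hb
    obtain ⟨u, v, w, -, -, -, rfl⟩ := Finset.card_eq_three.mp hb.1
    refine (Finset.card_le_card (t := {(u, v, w), (u, w, v), (v, u, w), (v, w, u), (w, u, v),
      (w, v, u)}) ?_).trans Finset.card_le_six
    rintro ⟨x, y, z⟩ h
    simp only [Finset.mem_filter, Finset.mem_univ, true_and] at h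
    obtain ⟨⟨hxy, hxz, hyz, -⟩, h⟩ := h
    have hx : x ∈ ({u, v, w} : Finset V) := h ▸ by simp
    have hy : y ∈ ({u, v, w} : Finset V) := h ▸ by simp
    have hz : z ∈ ({u, v, w} : Finset V) := h ▸ by simp
    simp only [Finset.mem_insert, Finset.mem_singleton, Prod.mk.injEq] at hx hy hz ⊢
    grind

theorem sum_transInd_le (G : OrientedGraph V) :
    ∑ x, ∑ y, ∑ z, transInd (G.rel x y) (G.rel x z) (G.rel y z) ≤ 6 * G.T3 := by
  refine le_trans ?_ (sum_ite_le_six_mul_card G.isTransTriangle)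
  refine Finset.sum_le_sum fun x _ => Finset.sum_le_sum fun y _ => Finset.sum_le_sum fun z _ => ?_
  have irr (v : V) : ¬ G.adj v v := fun h => G.asymm v v h h
  have ne {u v : V} (h : G.adj u v) : u ≠ v := by rintro rfl; exact irr _ h
  have hite (a b c : V) (hs : ({x, y, z} : Finset V) = {a, b, c}) (hab : G.adj a b)
      (hbc : G.adj b c) (hac : G.adj a c) (h1 : x ≠ y) (h2 : x ≠ z) (h3 : y ≠ z) :
      (1 : ℤ) ≤ if x ≠ y ∧ x ≠ z ∧ y ≠ z ∧ G.isTransTriangle {x, y, z} then 1 else 0 := by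
    rw [if_pos ⟨h1, h2, h3, a, b, c, hs, hab, hbc, hac⟩]
  have h0 : (0 : ℤ) ≤ if x ≠ y ∧ x ≠ z ∧ y ≠ z ∧ G.isTransTriangle {x, y, z} then 1 else 0 := by
    split_ifs <;> norm_num
  have hcases : ∀ r s t : Fin 3, transInd r s t = 0 ∨ transInd r s t = 1 ∧
      (r = 1 ∧ s = 1 ∧ t = 1 ∨ r = 1 ∧ s = 1 ∧ t = 2 ∨ r = 1 ∧ s = 2 ∧ t = 2 ∨
        r = 2 ∧ s = 2 ∧ t = 2 ∨ r = 2 ∧ s = 2 ∧ t = 1 ∨ r = 2 ∧ s = 1 ∧ t = 1) := by decide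
  rcases hcases (G.rel x y) (G.rel x z) (G.rel y z) with h | ⟨h, h'⟩
  · rwa [h]
  rw [h]
  simp only [rel_eq_one, rel_eq_two] at h'
  rcases h' with ⟨hxy, hxz, hyz⟩ | ⟨hxy, hxz, hyz⟩ | ⟨hxy, hxz, hyz⟩ | ⟨hxy, hxz, hyz⟩ |
    ⟨hxy, hxz, hyz⟩ | ⟨hxy, hxz, hyz⟩
  · exact hite x y z rfl hxy hyz hxz (ne hxy) (ne hxz) (ne hyz)
  · exact hite x z y (by grind) hxz hyz hxy (ne hxy) (ne hxz) (ne hyz).symm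
  · exact hite z x y (by grind) hxz hxy hyz (ne hxy) (ne hxz).symm (ne hyz).symm
  · exact hite z y x (by grind) hyz hxy hxz (ne hxy).symm (ne hxz).symm (ne hyz).symm
  · exact hite y z x (by grind) hyz hxz hxy (ne hxy).symm (ne hxz).symm (ne hyz)
  · exact hite y x z (by grind) hxy hxz hyz (ne hxy).symm (ne hxz) (ne hyz)

theorem sum_indepInd_le (G : OrientedGraph V) :
    ∑ x, ∑ y, ∑ z, indepInd (G.rel x y) (G.rel x z) (G.rel y z) ≤
      6 * G.I3 + 3 * (Fintype.card V : ℤ) ^ 2 := by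
  have hle : ∑ x, ∑ y, ∑ z, indepInd (G.rel x y) (G.rel x z) (G.rel y z) ≤
      ∑ x : V, ∑ y : V, ∑ z : V,
        ((if x ≠ y ∧ x ≠ z ∧ y ≠ z ∧ G.isIndep {x, y, z} then 1 else 0 : ℤ) +
          (if x = y then 1 else 0) + (if x = z then 1 else 0) + (if y = z then 1 else 0)) := by
    refine Finset.sum_le_sum fun x _ => Finset.sum_le_sum fun y _ =>
      Finset.sum_le_sum fun z _ => ?_
    have hcases : ∀ r s t : Fin 3, indepInd r s t = 0 ∨
        indepInd r s t = 1 ∧ r = 0 ∧ s = 0 ∧ t = 0 := by decide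
    rcases hcases (G.rel x y) (G.rel x z) (G.rel y z) with h | ⟨h, hr, hs, ht⟩
    · rw [h]
      positivity
    · rw [h]
      have irr (v : V) : ¬ G.adj v v := fun h => G.asymm v v h h
      have hind : G.isIndep {x, y, z} := by
        rw [rel_eq_zero] at hr hs ht
        simp only [isIndep, Finset.mem_insert, Finset.mem_singleton]
        rintro u (rfl | rfl | rfl) v (rfl | rfl | rfl) <;> tauto
      split_ifs <;> tauto
  refine hle.trans ?_
  have h := sum_ite_le_six_mul_card G.isIndep
  simp only [Finset.sum_add_distrib]
  have h1 : ∑ x : V, ∑ y : V, ∑ z : V, (if x = y then 1 else 0 : ℤ) = Fintype.card V ^ 2 := by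
    simp [pow_two]
  have h2 : ∑ x : V, ∑ y : V, ∑ z : V, (if x = z then 1 else 0 : ℤ) = Fintype.card V ^ 2 := by
    simp [pow_two]
  have h3 : ∑ x : V, ∑ y : V, ∑ z : V, (if y = z then 1 else 0 : ℤ) = Fintype.card V ^ 2 := by
    simp [pow_two]
  unfold I3
  linarith

/-- The quantitative bound `T₃ + I₃ ≥ n³/54 - n²/2`. -/
theorem card_pow_three_le (G : OrientedGraph V) :
    Fintype.card V ^ 3 ≤ 54 * (G.T3 + G.I3) + 27 * Fintype.card V ^ 2 := by
  have h := G.card_pow_three_le_sum_monoInd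
  simp only [monoInd, Finset.sum_add_distrib] at h
  have hT := G.sum_transInd_le
  have hI := G.sum_indepInd_le
  zify
  linarith

end Sums

end OrientedGraph

/-- For every ε > 0 there exists n₀ such that every oriented graph `G` on
`n ≥ n₀` vertices satisfies `t(G) + i(G) ≥ 1/9 − ε`. -/
theorem stmt_2 (ε : ℝ) (hε : 0 < ε) :
    ∃ n₀ : ℕ, 0 < n₀ ∧ ∀ n : ℕ, n₀ ≤ n → ∀ G : OrientedGraph (Fin n),
      1 / 9 - ε ≤ G.tDens + G.iDens := by
  obtain ⟨m, hm⟩ := exists_nat_gt (3 / ε)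
  refine ⟨m + 3, by omega, fun n hn G => ?_⟩
  have hT : 0 ≤ G.tDens := by unfold OrientedGraph.tDens; positivity
  have hI : 0 ≤ G.iDens := by unfold OrientedGraph.iDens; positivity
  rcases le_or_gt (1 / 9 - ε) 0 with h0 | h0
  · linarith
  have hmn : (m : ℝ) ≤ n := by exact_mod_cast (by omega : m ≤ n)
  have hn0 : (0 : ℝ) < n := by exact_mod_cast (by omega : 0 < n)
  have hεn : 3 ≤ ε * n := by
    rw [div_lt_iff₀ hε] at hm
    nlinarith
  have hmain : (n : ℝ) ^ 3 ≤ 54 * (G.T3 + G.I3) + 27 * n ^ 2 := by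
    have h := G.card_pow_three_le
    rw [Fintype.card_fin] at h
    exact_mod_cast h
  have hchoose : (n.choose 3 : ℝ) ≤ n ^ 3 / 6 := by
    simpa [Nat.factorial] using Nat.choose_le_pow_div (α := ℝ) 3 n
  have hpos : (0 : ℝ) < n.choose 3 := by exact_mod_cast Nat.choose_pos (by omega)
  unfold OrientedGraph.tDens OrientedGraph.iDens
  rw [Fintype.card_fin, ← add_div, le_div_iff₀ hpos]
  calc (1 / 9 - ε) * (n.choose 3 : ℝ) ≤ (1 / 9 - ε) * (n ^ 3 / 6) := by gcongr
    _ ≤ G.T3 + G.I3 := by nlinarith [mul_le_mul_of_nonneg_right hεn (sq_nonneg (n : ℝ))]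
end

section
/- For every ε > 0 there exists a positive integer n₀ such that every finite simple (undirected) graph G on n ≥ n₀ vertices satisfies Δ(G) + Δ̄(G) ≥ 1/4 − ε. -/
open scoped Classical

namespace GoodmanStmt

variable {V : Type} [Fintype V] [DecidableEq V]

/-- A 3-element vertex set spans a triangle: all three pairs are adjacent. -/
def isTriangle (G : SimpleGraph V) (s : Finset V) : Prop :=
  ∃ x y z : V, s = {x, y, z} ∧ G.Adj x y ∧ G.Adj y z ∧ G.Adj x z

/-- A vertex set is independent: no two of its vertices are adjacent. -/
def isIndep (G : SimpleGraph V) (s : Finset V) : Prop :=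
  ∀ x ∈ s, ∀ y ∈ s, ¬ G.Adj x y

/-- The number of 3-element vertex sets spanning a triangle. -/
noncomputable def triCount (G : SimpleGraph V) : ℕ :=
  ((Finset.univ.powersetCard 3 : Finset (Finset V)).filter (isTriangle G)).card

/-- The number of independent 3-element vertex sets. -/
noncomputable def indepCount (G : SimpleGraph V) : ℕ :=
  ((Finset.univ.powersetCard 3 : Finset (Finset V)).filter (isIndep G)).card

/-- `Δ(G)`: the probability that a uniformly random 3-element vertex set spans
a triangle. -/
noncomputable def triDens (G : SimpleGraph V) : ℝ :=
  (triCount G : ℝ) / ((Fintype.card V).choose 3 : ℝ)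

/-- `Δ̄(G)`: the probability that a uniformly random 3-element vertex set is
independent. -/
noncomputable def indepDens (G : SimpleGraph V) : ℝ :=
  (indepCount G : ℝ) / ((Fintype.card V).choose 3 : ℝ)

end GoodmanStmt

open GoodmanStmt

namespace GoodmanStmt

/-- The sign of a pair of vertices: `1` if they are adjacent and `-1` otherwise. -/
noncomputable def pairSign {V : Type*} (G : SimpleGraph V) (x y : V) : ℝ :=
  if G.Adj x y then 1 else -1

/-- An ordered triple of vertices whose three pairs have the same adjacency status. -/
def IsMono {V : Type*} (G : SimpleGraph V) (t : V × V × V) : Prop :=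
  (G.Adj t.1 t.2.1 ↔ G.Adj t.2.1 t.2.2) ∧ (G.Adj t.2.1 t.2.2 ↔ G.Adj t.1 t.2.2)

theorem pairSign_comm {V : Type*} (G : SimpleGraph V) (x y : V) :
    pairSign G x y = pairSign G y x := by
  simp only [pairSign, G.adj_comm]

theorem ite_isMono_eq {V : Type*} (G : SimpleGraph V) (x y z : V) :
    (if IsMono G (x, y, z) then (1 : ℝ) else 0) =
      (1 + pairSign G y x * pairSign G y z + pairSign G z x * pairSign G z y +
        pairSign G x y * pairSign G x z) / 4 := by
  rw [pairSign_comm G y x, pairSign_comm G z x, pairSign_comm G z y]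
  by_cases h₁ : G.Adj x y <;> by_cases h₂ : G.Adj y z <;> by_cases h₃ : G.Adj x z <;>
    norm_num [IsMono, pairSign, h₁, h₂, h₃]

theorem sum_mul_nonneg {V : Type*} [Fintype V] (f : V → V → ℝ) :
    0 ≤ ∑ x, ∑ y, ∑ z, f x y * f x z := by
  refine Finset.sum_nonneg fun x _ => ?_
  rw [← Finset.sum_mul_sum]
  exact mul_self_nonneg _

theorem card_cube_div_four_le_card_isMono {V : Type*} [Fintype V] (G : SimpleGraph V) :
    (Fintype.card V : ℝ) ^ 3 / 4 ≤
      ((Finset.univ.filter (IsMono G) : Finset (V × V × V)).card : ℝ) := by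
  have hx := sum_mul_nonneg (pairSign G)
  have hy : 0 ≤ ∑ x, ∑ y, ∑ z, pairSign G y x * pairSign G y z := by
    rw [Finset.sum_comm]
    exact hx
  have hz : 0 ≤ ∑ x, ∑ y, ∑ z, pairSign G z x * pairSign G z y := by
    have h : ∑ x, ∑ y, ∑ z, pairSign G z x * pairSign G z y =
        ∑ x, ∑ z, ∑ y, pairSign G z x * pairSign G z y :=
      Finset.sum_congr rfl fun x _ => Finset.sum_comm
    rw [h, Finset.sum_comm]
    exact hx
  rw [Finset.card_filter]
  push_cast
  simp only [Fintype.sum_prod_type, ite_isMono_eq, ← Finset.sum_div, Finset.sum_add_distrib,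
    Finset.sum_const, Finset.card_univ, nsmul_eq_mul, mul_one]
  rw [show (Fintype.card V : ℝ) ^ 3 = Fintype.card V * (Fintype.card V * Fintype.card V) by ring]
  linarith

theorem card_filter_triple_eq_le {V : Type} [Fintype V] [DecidableEq V] (s : Finset V)
    (hs : s.card = 3) (T : Finset (V × V × V)) :
    (T.filter fun t => ({t.1, t.2.1, t.2.2} : Finset V) = s).card ≤ 6 := by
  obtain ⟨a, b, c, hab, hac, hbc, rfl⟩ := Finset.card_eq_three.1 hs
  refine (Finset.card_le_card (t := {(a, b, c), (a, c, b), (b, a, c), (b, c, a), (c, a, b),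
    (c, b, a)}) ?_).trans Finset.card_le_six
  rintro ⟨x, y, z⟩ h
  have h' := (Finset.mem_filter.1 h).2
  have hx : x ∈ ({a, b, c} : Finset V) := by rw [← h']; simp
  have hy : y ∈ ({a, b, c} : Finset V) := by rw [← h']; simp
  have hz : z ∈ ({a, b, c} : Finset V) := by rw [← h']; simp
  have ha : a ∈ ({x, y, z} : Finset V) := by rw [h']; simp
  have hb : b ∈ ({x, y, z} : Finset V) := by rw [h']; simp
  have hc : c ∈ ({x, y, z} : Finset V) := by rw [h']; simp
  simp only [Finset.mem_insert, Finset.mem_singleton, Prod.mk.injEq] at hx hy hz ha hb hc ⊢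
  grind

theorem card_isMono_le {V : Type} [Fintype V] [DecidableEq V] (G : SimpleGraph V) :
    (Finset.univ.filter (IsMono G) : Finset (V × V × V)).card ≤
      6 * (triCount G + indepCount G) + 3 * Fintype.card V ^ 2 := by
  set D : Finset (V × V × V) := Finset.univ.filter fun t =>
    IsMono G t ∧ t.1 ≠ t.2.1 ∧ t.2.1 ≠ t.2.2 ∧ t.1 ≠ t.2.2 with hD
  set S : Finset (Finset V) := (Finset.univ.powersetCard 3).filter (isTriangle G) ∪
    (Finset.univ.powersetCard 3).filter (isIndep G) with hS
  have hDS : D.card ≤ 6 * S.card := by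
    refine Finset.card_le_mul_card_image_of_maps_to
      (f := fun t : V × V × V => ({t.1, t.2.1, t.2.2} : Finset V)) ?_ 6 ?_
    · rintro ⟨x, y, z⟩ h
      obtain ⟨⟨h₁, h₂⟩, hxy, hyz, hxz⟩ := (Finset.mem_filter.1 h).2
      have h3 : ({x, y, z} : Finset V).card = 3 := Finset.card_eq_three.2
        ⟨x, y, z, hxy, hxz, hyz, rfl⟩
      simp only [hS, Finset.mem_union, Finset.mem_filter, Finset.mem_powersetCard,
        Finset.subset_univ, true_and, h3]
      by_cases h : G.Adj x y
      · exact Or.inl ⟨x, y, z, rfl, h, h₁.1 h, h₂.1 (h₁.1 h)⟩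
      · have hyz' : ¬ G.Adj y z := fun h' => h (h₁.2 h')
        have hxz' : ¬ G.Adj x z := fun h' => hyz' (h₂.2 h')
        refine Or.inr fun u hu v hv => ?_
        simp only [Finset.mem_insert, Finset.mem_singleton] at hu hv
        rcases hu with rfl | rfl | rfl <;> rcases hv with rfl | rfl | rfl <;>
          first
          | exact G.irrefl
          | assumption
          | (rw [G.adj_comm]; assumption)
    · intro s hs
      refine card_filter_triple_eq_le s ?_ D
      simp only [hS, Finset.mem_union, Finset.mem_filter, Finset.mem_powersetCard] at hs
      tauto
  have hSc : S.card ≤ triCount G + indepCount G := Finset.card_union_le _ _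
  have hcover : (Finset.univ.filter (IsMono G) : Finset (V × V × V)) ⊆
      D ∪ ((Finset.univ.image fun p : V × V => (p.1, p.1, p.2)) ∪
        ((Finset.univ.image fun p : V × V => (p.1, p.2, p.2)) ∪
          (Finset.univ.image fun p : V × V => (p.1, p.2, p.1)))) := by
    rintro ⟨x, y, z⟩ h
    have h' := (Finset.mem_filter.1 h).2
    simp only [hD, Finset.mem_union, Finset.mem_filter, Finset.mem_image, Finset.mem_univ,
      true_and, Prod.exists, Prod.mk.injEq, h']
    by_cases hxy : x = y
    · exact Or.inr (Or.inl ⟨x, z, rfl, hxy, rfl⟩)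
    by_cases hyz : y = z
    · exact Or.inr (Or.inr (Or.inl ⟨x, y, rfl, rfl, hyz⟩))
    by_cases hxz : x = z
    · exact Or.inr (Or.inr (Or.inr ⟨x, y, rfl, rfl, hxz⟩))
    exact Or.inl ⟨hxy, hyz, hxz⟩
  have himage (f : V × V → V × V × V) :
      (Finset.univ.image f).card ≤ Fintype.card V ^ 2 := by
    refine Finset.card_image_le.trans_eq ?_
    rw [Finset.card_univ, Fintype.card_prod, sq]
  have h₀ := Finset.card_le_card hcover
  have h₁ := Finset.card_union_le D ((Finset.univ.image fun p : V × V => (p.1, p.1, p.2)) ∪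
        ((Finset.univ.image fun p : V × V => (p.1, p.2, p.2)) ∪
          (Finset.univ.image fun p : V × V => (p.1, p.2, p.1))))
  have h₂ := Finset.card_union_le (Finset.univ.image fun p : V × V => (p.1, p.1, p.2))
        ((Finset.univ.image fun p : V × V => (p.1, p.2, p.2)) ∪
          (Finset.univ.image fun p : V × V => (p.1, p.2, p.1)))
  have h₃ := Finset.card_union_le (Finset.univ.image fun p : V × V => (p.1, p.2, p.2))
          (Finset.univ.image fun p : V × V => (p.1, p.2, p.1))
  have h₄ := himage fun p => (p.1, p.1, p.2)
  have h₅ := himage fun p => (p.1, p.2, p.2)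
  have h₆ := himage fun p => (p.1, p.2, p.1)
  omega

theorem one_fourth_sub_le_triDens_add_indepDens {V : Type} [Fintype V] [DecidableEq V]
    (G : SimpleGraph V) (hV : 12 ≤ Fintype.card V) :
    1 / 4 - 3 / (Fintype.card V : ℝ) ≤ triDens G + indepDens G := by
  have hlow := card_cube_div_four_le_card_isMono G
  have hup : ((Finset.univ.filter (IsMono G) : Finset (V × V × V)).card : ℝ) ≤
      6 * ((triCount G : ℝ) + indepCount G) + 3 * (Fintype.card V : ℝ) ^ 2 := by
    exact_mod_cast card_isMono_le G
  rw [triDens, indepDens, ← add_div]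
  set n := Fintype.card V
  have hn : (12 : ℝ) ≤ n := by exact_mod_cast hV
  have hpos : (0 : ℝ) < (n.choose 3 : ℝ) := by
    exact_mod_cast Nat.choose_pos (by omega)
  have hchoose : (n.choose 3 : ℝ) ≤ (n : ℝ) ^ 3 / 6 := by
    simpa [Nat.factorial] using Nat.choose_le_pow_div (α := ℝ) 3 n
  have hcoef : 0 ≤ 1 / 4 - 3 / (n : ℝ) := by
    rw [sub_nonneg, div_le_div_iff₀ (by linarith) (by norm_num)]
    linarith
  rw [le_div_iff₀ hpos]
  refine (mul_le_mul_of_nonneg_left hchoose hcoef).trans ?_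
  have : (1 / 4 - 3 / (n : ℝ)) * ((n : ℝ) ^ 3 / 6) = ((n : ℝ) ^ 3 / 4 - 3 * (n : ℝ) ^ 2) / 6 := by
    field_simp
  linarith

end GoodmanStmt

/-- Goodman's bound: for every ε > 0 there is n₀ such that every simple graph
on `n ≥ n₀` vertices satisfies `Δ(G) + Δ̄(G) ≥ 1/4 − ε`. -/
theorem stmt_5 (ε : ℝ) (hε : 0 < ε) :
    ∃ n₀ : ℕ, 0 < n₀ ∧ ∀ n : ℕ, n₀ ≤ n → ∀ G : SimpleGraph (Fin n),
      1 / 4 - ε ≤ triDens G + indepDens G := by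
  refine ⟨max 12 ⌈3 / ε⌉₊, by positivity, fun n hn G => ?_⟩
  have hn12 : 12 ≤ n := (le_max_left _ _).trans hn
  have hnε : 3 / ε ≤ (n : ℝ) := Nat.ceil_le.1 ((le_max_right _ _).trans hn)
  have hpos : (0 : ℝ) < n := by exact_mod_cast (by omega : 0 < n)
  have hdens := one_fourth_sub_le_triDens_add_indepDens G (by simpa using hn12)
  have hsmall : 3 / (n : ℝ) ≤ ε := by
    rw [div_le_iff₀ hε] at hnε
    rw [div_le_iff₀ hpos]
    linarith
  simp only [Fintype.card_fin] at hdens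
  convert (sub_le_sub_left hsmall (1 / 4)).trans hdens
end

section
/- Every finite simple (undirected) graph G on n ≥ 3 vertices with m edges satisfies the identity Δ(G) + Δ̄(G) = 1 − 6m/(n(n−2)) + (1/(2·C(n,3)))·∑_{v ∈ V(G)} d(v)², where d(v) is the degree of v. -/
open scoped Classical

open GoodmanStmt

namespace GoodmanStmt

variable {V : Type} [Fintype V] [DecidableEq V]

/-- Ordered triples `(v, a, b)` where `a` is a neighbour of `v` and `b` is a non-neighbour. -/
noncomputable def mixedTriples (G : SimpleGraph V) : Finset (V × V × V) :=
  Finset.univ.filter fun p => G.Adj p.1 p.2.1 ∧ Gᶜ.Adj p.1 p.2.2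

/-- The 3-element vertex sets that neither span a triangle nor are independent. -/
noncomputable def mixedSets (G : SimpleGraph V) : Finset (Finset V) :=
  (Finset.univ.powersetCard 3).filter fun s => ¬ isTriangle G s ∧ ¬ isIndep G s

theorem not_isIndep_of_isTriangle {W : Type} [DecidableEq W] {G : SimpleGraph W}
    {s : Finset W} (h : isTriangle G s) :
    ¬ isIndep G s := by
  obtain ⟨x, y, z, rfl, hxy, -, -⟩ := h
  exact fun hi => hi x (by simp) y (by simp) hxy

theorem triCount_add_indepCount_add_card_mixedSets (G : SimpleGraph V) :
    triCount G + indepCount G + (mixedSets G).card = (Fintype.card V).choose 3 := by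
  have hdisj : Disjoint
      ((Finset.univ.powersetCard 3 : Finset (Finset V)).filter (isTriangle G))
      ((Finset.univ.powersetCard 3 : Finset (Finset V)).filter (isIndep G)) :=
    Finset.disjoint_filter.2 fun _ _ h => not_isIndep_of_isTriangle h
  have hsplit := Finset.card_filter_add_card_filter_not
    (s := (Finset.univ.powersetCard 3 : Finset (Finset V)))
    (fun s => isTriangle G s ∨ isIndep G s)
  rw [Finset.card_powersetCard, Finset.card_univ, Finset.filter_or,
    Finset.card_union_of_disjoint hdisj] at hsplit
  simpa only [triCount, indepCount, mixedSets, not_or] using hsplit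

theorem card_mixedTriples (G : SimpleGraph V) [DecidableRel G.Adj] :
    (mixedTriples G).card = ∑ v : V, G.degree v * (Fintype.card V - 1 - G.degree v) := by
  have hmaps : ∀ p ∈ mixedTriples G, p.1 ∈ (Finset.univ : Finset V) := fun _ _ => Finset.mem_univ _
  rw [Finset.card_eq_sum_card_fiberwise hmaps]
  refine Finset.sum_congr rfl fun v _ => ?_
  have hfiber : (mixedTriples G).filter (fun p => p.1 = v) =
      {v} ×ˢ (G.neighborFinset v ×ˢ Gᶜ.neighborFinset v) := by
    ext ⟨x, a, b⟩
    simp only [mixedTriples, Finset.mem_filter, Finset.mem_univ, true_and, Finset.mem_product,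
      Finset.mem_singleton, SimpleGraph.mem_neighborFinset]
    constructor
    · rintro ⟨h, rfl⟩
      exact ⟨rfl, h⟩
    · rintro ⟨rfl, h⟩
      exact ⟨h, rfl⟩
  rw [hfiber, Finset.card_product, Finset.card_product, Finset.card_singleton, one_mul,
    SimpleGraph.card_neighborFinset_eq_degree, SimpleGraph.card_neighborFinset_eq_degree,
    SimpleGraph.degree_compl]

theorem insert_mem_mixedSets {G : SimpleGraph V} {v a b : V} (ha : G.Adj v a)
    (hb : Gᶜ.Adj v b) : ({v, a, b} : Finset V) ∈ mixedSets G := by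
  rw [SimpleGraph.compl_adj] at hb
  have hab : a ≠ b := by
    rintro rfl
    exact hb.2 ha
  refine Finset.mem_filter.2 ⟨Finset.mem_powersetCard.2 ⟨Finset.subset_univ _,
    Finset.card_eq_three.2 ⟨v, a, b, ha.ne, hb.1, hab, rfl⟩⟩, ?_, ?_⟩
  · rintro ⟨x, y, z, hs, hxy, hyz, hxz⟩
    have hv : v ∈ ({x, y, z} : Finset V) := hs ▸ by simp
    have hb' : b ∈ ({x, y, z} : Finset V) := hs ▸ by simp
    simp only [Finset.mem_insert, Finset.mem_singleton] at hv hb'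
    have := hxy.symm
    have := hyz.symm
    have := hxz.symm
    rcases hv with rfl | rfl | rfl <;> rcases hb' with rfl | rfl | rfl <;> tauto
  · exact fun h => h v (by simp) a (by simp) ha

theorem exists_mixedTriple_of_mem_mixedSets {G : SimpleGraph V} {s : Finset V}
    (hs : s ∈ mixedSets G) : ∃ x y z : V, G.Adj x y ∧ Gᶜ.Adj x z ∧ s = {x, y, z} := by
  obtain ⟨hcard, htri, hind⟩ := Finset.mem_filter.1 hs
  obtain ⟨x, y, z, hxy, hxz, hyz, rfl⟩ :=
    Finset.card_eq_three.1 (Finset.mem_powersetCard.1 hcard).2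
  have htri' : ¬ (G.Adj x y ∧ G.Adj y z ∧ G.Adj x z) := fun h => htri ⟨x, y, z, rfl, h⟩
  have hind' : G.Adj x y ∨ G.Adj y z ∨ G.Adj x z := by
    by_contra! h
    refine hind fun u hu w hw => ?_
    simp only [Finset.mem_insert, Finset.mem_singleton] at hu hw
    rcases hu with rfl | rfl | rfl <;> rcases hw with rfl | rfl | rfl <;>
      simp_all [G.adj_comm]
  simp only [SimpleGraph.compl_adj]
  by_cases h1 : G.Adj x y <;> by_cases h2 : G.Adj x z
  · exact ⟨y, x, z, h1.symm, ⟨hyz, fun h => htri' ⟨h1, h, h2⟩⟩, Finset.insert_comm _ _ _⟩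
  · exact ⟨x, y, z, h1, ⟨hxz, h2⟩, rfl⟩
  · exact ⟨x, z, y, h2, ⟨hxy, h1⟩, by rw [Finset.pair_comm]⟩
  · have h3 : G.Adj y z := by tauto
    exact ⟨y, z, x, h3, ⟨hxy.symm, fun h => h1 h.symm⟩, by
      rw [Finset.insert_comm, Finset.pair_comm x z]⟩

theorem card_fiber_mixedTriples {G : SimpleGraph V} {s : Finset V} (hs : s ∈ mixedSets G) :
    ((mixedTriples G).filter fun p => ({p.1, p.2.1, p.2.2} : Finset V) = s).card = 2 := by
  obtain ⟨x, y, z, hxy, hxz, rfl⟩ := exists_mixedTriple_of_mem_mixedSets hs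
  rw [SimpleGraph.compl_adj] at hxz
  obtain ⟨hne, hxz⟩ := hxz
  have hyx := hxy.symm
  have hzx : ¬ G.Adj z x := fun h => hxz h.symm
  have hxy_ne := hxy.ne
  have hyz_ne : y ≠ z := by
    rintro rfl
    exact hxz hxy
  have key : ∀ v a b : V, (v, a, b) ∈ (mixedTriples G).filter
      (fun p => ({p.1, p.2.1, p.2.2} : Finset V) = {x, y, z}) ↔
      G.Adj v a ∧ (v ≠ b ∧ ¬ G.Adj v b) ∧ (v = x ∨ v = y ∨ v = z) ∧
        (a = x ∨ a = y ∨ a = z) ∧ (b = x ∨ b = y ∨ b = z) := by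
    intro v a b
    simp only [mixedTriples, Finset.mem_filter, Finset.mem_univ, true_and,
      SimpleGraph.compl_adj]
    constructor
    · rintro ⟨⟨ha, hb⟩, h⟩
      have hsub : ∀ u ∈ ({v, a, b} : Finset V), u = x ∨ u = y ∨ u = z := fun u hu => by
        rwa [h, Finset.mem_insert, Finset.mem_insert, Finset.mem_singleton] at hu
      exact ⟨ha, hb, hsub v (by simp), hsub a (by simp), hsub b (by simp)⟩
    · rintro ⟨ha, hb, hv, ha', hb'⟩
      refine ⟨⟨ha, hb⟩, Finset.eq_of_subset_of_card_le ?_ ?_⟩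
      · intro u hu
        simp only [Finset.mem_insert, Finset.mem_singleton] at hu ⊢
        rcases hu with rfl | rfl | rfl <;> assumption
      · have hab : a ≠ b := by
          rintro rfl
          exact hb.2 ha
        rw [Finset.card_eq_three.2 ⟨v, a, b, ha.ne, hb.1, hab, rfl⟩]
        exact Finset.card_le_three
  rw [Finset.card_eq_two]
  by_cases hyz : G.Adj y z
  · refine ⟨(x, y, z), (z, y, x), by simp [hne], ?_⟩
    ext ⟨v, a, b⟩
    rw [key]
    simp only [Finset.mem_insert, Finset.mem_singleton, Prod.mk.injEq]
    have hzy := hyz.symm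
    constructor
    · rintro ⟨ha, ⟨hvb, hb⟩, rfl | rfl | rfl, rfl | rfl | rfl, rfl | rfl | rfl⟩ <;> simp_all
    · rintro (⟨rfl, rfl, rfl⟩ | ⟨rfl, rfl, rfl⟩)
      · simp_all
      · simp_all [Ne.symm hne]
  · refine ⟨(x, y, z), (y, x, z), by simp [hxy_ne], ?_⟩
    ext ⟨v, a, b⟩
    rw [key]
    simp only [Finset.mem_insert, Finset.mem_singleton, Prod.mk.injEq]
    have hzy : ¬ G.Adj z y := fun h => hyz h.symm
    constructor
    · rintro ⟨ha, ⟨hvb, hb⟩, rfl | rfl | rfl, rfl | rfl | rfl, rfl | rfl | rfl⟩ <;> simp_all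
    · rintro (⟨rfl, rfl, rfl⟩ | ⟨rfl, rfl, rfl⟩) <;> simp_all

theorem card_mixedTriples_eq_two_mul (G : SimpleGraph V) :
    (mixedTriples G).card = 2 * (mixedSets G).card := by
  have hmaps : ∀ p ∈ mixedTriples G, ({p.1, p.2.1, p.2.2} : Finset V) ∈ mixedSets G := by
    intro p hp
    obtain ⟨ha, hb⟩ := (Finset.mem_filter.1 hp).2
    exact insert_mem_mixedSets ha hb
  rw [Finset.card_eq_sum_card_fiberwise hmaps,
    Finset.sum_congr rfl fun s hs => card_fiber_mixedTriples hs, Finset.sum_const,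
    smul_eq_mul, mul_comm]

end GoodmanStmt

/-- Goodman's identity: for every simple graph `G` on `n ≥ 3` vertices with
`m` edges,
`Δ(G) + Δ̄(G) = 1 − 6m/(n(n−2)) + (1/(2·C(n,3)))·∑_v d(v)²`. -/
theorem stmt_6 {V : Type} [Fintype V] [DecidableEq V]
    (G : SimpleGraph V) [DecidableRel G.Adj] (hn : 3 ≤ Fintype.card V) :
    triDens G + indepDens G =
      1 - 6 * (G.edgeFinset.card : ℝ) /
            ((Fintype.card V : ℝ) * ((Fintype.card V : ℝ) - 2)) +
        (1 / (2 * ((Fintype.card V).choose 3 : ℝ))) *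
          ∑ v : V, (G.degree v : ℝ) ^ 2 := by
  have hcount := triCount_add_indepCount_add_card_mixedSets G
  have hmixed : 2 * (mixedSets G).card =
      ∑ v : V, G.degree v * (Fintype.card V - 1 - G.degree v) :=
    (card_mixedTriples_eq_two_mul G).symm.trans (card_mixedTriples G)
  have hedges : ∑ v : V, (G.degree v : ℝ) = 2 * (G.edgeFinset.card : ℝ) := by
    exact_mod_cast G.sum_degrees_eq_twice_card_edges
  have hmixedR : 2 * ((mixedSets G).card : ℝ) =
      2 * (G.edgeFinset.card : ℝ) * ((Fintype.card V : ℝ) - 1) -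
        ∑ v : V, (G.degree v : ℝ) ^ 2 := by
    rw [← hedges, Finset.sum_mul, ← Finset.sum_sub_distrib]
    have hcast : (2 * (mixedSets G).card : ℝ) =
        ∑ v : V, ((G.degree v * (Fintype.card V - 1 - G.degree v) : ℕ) : ℝ) := by
      exact_mod_cast hmixed
    rw [hcast]
    refine Finset.sum_congr rfl fun v _ => ?_
    have hdeg := G.degree_lt_card_verts v
    rw [Nat.cast_mul, Nat.cast_sub (by omega), Nat.cast_sub (by omega)]
    push_cast
    ring
  have hn' : (3 : ℝ) ≤ Fintype.card V := by exact_mod_cast hn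
  have hchoose : ((Fintype.card V).choose 3 : ℝ) =
      (Fintype.card V : ℝ) * ((Fintype.card V : ℝ) - 1) * ((Fintype.card V : ℝ) - 2) / 6 := by
    rw [Nat.cast_choose_eq_descPochhammer_div]
    simp [descPochhammer_succ_right, Nat.factorial]
  have hcountR : (triCount G : ℝ) + indepCount G + (mixedSets G).card =
      (Fintype.card V : ℝ) * ((Fintype.card V : ℝ) - 1) * ((Fintype.card V : ℝ) - 2) / 6 := by
    rw [← hchoose]
    exact_mod_cast hcount
  have h0 : (Fintype.card V : ℝ) ≠ 0 := by linarith
  have h1 : (Fintype.card V : ℝ) - 1 ≠ 0 := by linarith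
  have h2 : (Fintype.card V : ℝ) - 2 ≠ 0 := by linarith
  rw [triDens, indepDens, hchoose]
  field_simp
  linarith
end

section
/- For every ε > 0 there exists a positive integer n₀ such that every oriented graph G on n ≥ n₀ vertices satisfies t(G) + i(G) ≥ 1/10 − ε. -/
open scoped Classical

namespace OrientedGraph

/-- The 3-element sets counted by `T3` or `I3`. -/
noncomputable def goodTriples {V : Type} [Fintype V] [DecidableEq V] (G : OrientedGraph V) :
    Finset (Finset V) :=
  (Finset.univ.powersetCard 3).filter fun s => G.isTransTriangle s ∨ G.isIndep s

lemma card_goodTriples_le {V : Type} [Fintype V] [DecidableEq V] (G : OrientedGraph V) :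
    G.goodTriples.card ≤ G.T3 + G.I3 := by
  rw [goodTriples, Finset.filter_or]
  exact Finset.card_union_le _ _

lemma card_orderings_le_six {V : Type} [Fintype V] [DecidableEq V] (s : Finset V)
    (hs : s.card = 3) :
    (Finset.univ.filter fun p : V × V × V => ({p.1, p.2.1, p.2.2} : Finset V) = s).card ≤ 6 := by
  obtain ⟨a, b, c, hab, hac, hbc, rfl⟩ := Finset.card_eq_three.mp hs
  refine (Finset.card_le_card (t := {(a, b, c), (a, c, b), (b, a, c), (b, c, a), (c, a, b),
    (c, b, a)}) ?_).trans Finset.card_le_six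
  rintro ⟨x, y, z⟩ h
  simp only [Finset.mem_filter, Finset.mem_univ, true_and] at h
  have ha : a ∈ ({x, y, z} : Finset V) := by rw [h]; simp
  have hb : b ∈ ({x, y, z} : Finset V) := by rw [h]; simp
  have hc : c ∈ ({x, y, z} : Finset V) := by rw [h]; simp
  simp only [Finset.mem_insert, Finset.mem_singleton, Prod.mk.injEq] at ha hb hc ⊢
  grind

lemma card_orderedGoodTriples_le {V : Type} [Fintype V] [DecidableEq V] (G : OrientedGraph V) :
    (Finset.univ.filter fun p : V × V × V => {p.1, p.2.1, p.2.2} ∈ G.goodTriples).card ≤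
      6 * (G.T3 + G.I3) := by
  refine (Finset.card_le_mul_card_image_of_maps_to (t := G.goodTriples)
    (f := fun p : V × V × V => ({p.1, p.2.1, p.2.2} : Finset V)) (fun p hp => ?_) 6
    (fun s hs => ?_)).trans (Nat.mul_le_mul_left 6 G.card_goodTriples_le)
  · exact (Finset.mem_filter.mp hp).2
  · refine (Finset.card_le_card ?_).trans (card_orderings_le_six s
      (Finset.mem_powersetCard.mp (Finset.mem_filter.mp hs).1).2)
    exact Finset.filter_subset_filter _ (Finset.subset_univ _)

/-- The sign of the arc between `u` and `v`, seen from `u`. -/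
noncomputable def arcSign {V : Type} [Fintype V] [DecidableEq V] (G : OrientedGraph V)
    (u v : V) : ℝ :=
  if G.adj u v then 1 else if G.adj v u then -1 else 0

/-- Weight `2` on adjacent pairs, `-3` on nonadjacent pairs. -/
noncomputable def adjWeight {V : Type} [Fintype V] [DecidableEq V] (G : OrientedGraph V)
    (u v : V) : ℝ :=
  if G.adj u v ∨ G.adj v u then 2 else -3

/-- The kernel of the quadratic form `5 (d⁺ - d⁻)² + (2 (d⁺ + d⁻) - 3 d⁰)²` in the numbers
of out-neighbours, in-neighbours and non-neighbours of `v`. -/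
noncomputable def degreeKernel {V : Type} [Fintype V] [DecidableEq V] (G : OrientedGraph V)
    (v u w : V) : ℝ :=
  5 * (G.arcSign v u * G.arcSign v w) + G.adjWeight v u * G.adjWeight v w

lemma sum_degreeKernel_nonneg {V : Type} [Fintype V] [DecidableEq V] (G : OrientedGraph V) :
    0 ≤ ∑ v, ∑ u, ∑ w, G.degreeKernel v u w := by
  refine Finset.sum_nonneg fun v _ => ?_
  have h : ∑ u, ∑ w, G.degreeKernel v u w =
      5 * (∑ u, G.arcSign v u) ^ 2 + (∑ u, G.adjWeight v u) ^ 2 := by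
    simp only [degreeKernel, Finset.sum_add_distrib, ← Finset.mul_sum, ← Finset.sum_mul, sq]
  rw [h]
  positivity

lemma degreeKernel_le {V : Type} [Fintype V] [DecidableEq V] (G : OrientedGraph V)
    (v u w : V) : G.degreeKernel v u w ≤ 14 := by
  unfold degreeKernel arcSign adjWeight
  split_ifs <;> norm_num

lemma mem_goodTriples_of_adj {V : Type} [Fintype V] [DecidableEq V] (G : OrientedGraph V)
    {s : Finset V} (hs : s.card = 3) {x y z : V} (h : s = {x, y, z}) (hxy : G.adj x y)
    (hyz : G.adj y z) (hxz : G.adj x z) : s ∈ G.goodTriples :=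
  Finset.mem_filter.mpr ⟨Finset.mem_powersetCard.mpr ⟨Finset.subset_univ _, hs⟩,
    Or.inl ⟨x, y, z, h, hxy, hyz, hxz⟩⟩

lemma mem_goodTriples_of_not_adj {V : Type} [Fintype V] [DecidableEq V] (G : OrientedGraph V)
    {x y z : V} (hs : ({x, y, z} : Finset V).card = 3) (hxy : ¬ G.adj x y) (hyx : ¬ G.adj y x)
    (hxz : ¬ G.adj x z) (hzx : ¬ G.adj z x) (hyz : ¬ G.adj y z) (hzy : ¬ G.adj z y) :
    {x, y, z} ∈ G.goodTriples := by
  have hirr : ∀ v, ¬ G.adj v v := fun v h => G.asymm v v h h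
  refine Finset.mem_filter.mpr ⟨Finset.mem_powersetCard.mpr ⟨Finset.subset_univ _, hs⟩,
    Or.inr fun a ha b hb => ?_⟩
  simp only [Finset.mem_insert, Finset.mem_singleton] at ha hb
  rcases ha with ha | ha | ha <;> rcases hb with hb | hb | hb <;> rw [ha, hb] <;>
    first | assumption | exact hirr _

lemma arcSign_adjWeight_cases {V : Type} [Fintype V] [DecidableEq V] (G : OrientedGraph V)
    (u v : V) :
    (G.adj u v ∧ G.arcSign u v = 1 ∧ G.arcSign v u = -1 ∧
      G.adjWeight u v = 2 ∧ G.adjWeight v u = 2) ∨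
    (G.adj v u ∧ G.arcSign u v = -1 ∧ G.arcSign v u = 1 ∧
      G.adjWeight u v = 2 ∧ G.adjWeight v u = 2) ∨
    ((¬ G.adj u v ∧ ¬ G.adj v u) ∧ G.arcSign u v = 0 ∧ G.arcSign v u = 0 ∧
      G.adjWeight u v = -3 ∧ G.adjWeight v u = -3) := by
  unfold arcSign adjWeight
  have h := G.asymm u v
  by_cases huv : G.adj u v
  · simp [huv, h huv]
  · by_cases hvu : G.adj v u <;> simp [huv, hvu]

lemma degreeKernel_symm_le_of_distinct {V : Type} [Fintype V] [DecidableEq V]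
    (G : OrientedGraph V) {x y z : V} (hxy : x ≠ y) (hxz : x ≠ z) (hyz : y ≠ z) :
    G.degreeKernel x y z + G.degreeKernel y z x + G.degreeKernel z x y ≤
      30 * (if {x, y, z} ∈ G.goodTriples then 1 else 0) - 3 := by
  have hs : ({x, y, z} : Finset V).card = 3 :=
    Finset.card_eq_three.mpr ⟨x, y, z, hxy, hxz, hyz, rfl⟩
  have hyx : ({x, y, z} : Finset V) = {y, x, z} := Finset.insert_comm _ _ _
  have hzy : ({x, y, z} : Finset V) = {x, z, y} := by rw [Finset.pair_comm]
  have hyzx : ({x, y, z} : Finset V) = {y, z, x} := by rw [hyx, Finset.pair_comm]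
  have hzxy : ({x, y, z} : Finset V) = {z, x, y} := by rw [hzy, Finset.insert_comm]
  have hzyx : ({x, y, z} : Finset V) = {z, y, x} := by rw [hzxy, Finset.pair_comm]
  have hnonneg : (0 : ℝ) ≤ if {x, y, z} ∈ G.goodTriples then 1 else 0 := by positivity
  unfold degreeKernel
  rcases G.arcSign_adjWeight_cases x y with ⟨a, e₁, e₂, e₃, e₄⟩ | ⟨a, e₁, e₂, e₃, e₄⟩ |
      ⟨a, e₁, e₂, e₃, e₄⟩ <;>
    rcases G.arcSign_adjWeight_cases x z with ⟨b, f₁, f₂, f₃, f₄⟩ | ⟨b, f₁, f₂, f₃, f₄⟩ |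
      ⟨b, f₁, f₂, f₃, f₄⟩ <;>
    rcases G.arcSign_adjWeight_cases y z with ⟨c, g₁, g₂, g₃, g₄⟩ | ⟨c, g₁, g₂, g₃, g₄⟩ |
      ⟨c, g₁, g₂, g₃, g₄⟩ <;>
    rw [e₁, e₂, e₃, e₄, f₁, f₂, f₃, f₄, g₁, g₂, g₃, g₄] <;>
    first
    | linarith
    | rw [if_pos (G.mem_goodTriples_of_adj hs rfl a c b)]; norm_num
    | rw [if_pos (G.mem_goodTriples_of_adj hs hzy b c a)]; norm_num
    | rw [if_pos (G.mem_goodTriples_of_adj hs hyx a b c)]; norm_num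
    | rw [if_pos (G.mem_goodTriples_of_adj hs hyzx c b a)]; norm_num
    | rw [if_pos (G.mem_goodTriples_of_adj hs hzxy b a c)]; norm_num
    | rw [if_pos (G.mem_goodTriples_of_adj hs hzyx c a b)]; norm_num
    | rw [if_pos (G.mem_goodTriples_of_not_adj hs a.1 a.2 b.1 b.2 c.1 c.2)]; norm_num

lemma degreeKernel_symm_le {V : Type} [Fintype V] [DecidableEq V] (G : OrientedGraph V)
    (x y z : V) :
    G.degreeKernel x y z + G.degreeKernel y z x + G.degreeKernel z x y ≤
      30 * (if {x, y, z} ∈ G.goodTriples then 1 else 0) - 3 +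
        45 * ((if x = y then 1 else 0) + (if x = z then 1 else 0) + (if y = z then 1 else 0)) := by
  have hx := G.degreeKernel_le x y z
  have hy := G.degreeKernel_le y z x
  have hz := G.degreeKernel_le z x y
  have hgood : (0 : ℝ) ≤ if {x, y, z} ∈ G.goodTriples then 1 else 0 := by positivity
  by_cases hd : x ≠ y ∧ x ≠ z ∧ y ≠ z
  · have h := G.degreeKernel_symm_le_of_distinct hd.1 hd.2.1 hd.2.2
    simp only [if_neg hd.1, if_neg hd.2.1, if_neg hd.2.2]
    linarith
  · have h : (1 : ℝ) ≤ (if x = y then 1 else 0) + (if x = z then 1 else 0) +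
        (if y = z then 1 else 0) := by
      split_ifs <;> first | norm_num; done | tauto
    linarith

lemma cube_le_T3_add_I3 {V : Type} [Fintype V] [DecidableEq V] (G : OrientedGraph V) :
    3 * (Fintype.card V : ℝ) ^ 3 - 135 * (Fintype.card V : ℝ) ^ 2 ≤
      180 * ((G.T3 : ℝ) + G.I3) := by
  have hpos := G.sum_degreeKernel_nonneg
  have hy : ∑ x, ∑ y, ∑ z, G.degreeKernel y z x = ∑ v, ∑ u, ∑ w, G.degreeKernel v u w := by
    rw [Finset.sum_comm]
    exact Finset.sum_congr rfl fun _ _ => Finset.sum_comm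
  have hz : ∑ x, ∑ y, ∑ z, G.degreeKernel z x y = ∑ v, ∑ u, ∑ w, G.degreeKernel v u w := by
    rw [Finset.sum_congr rfl fun _ _ => Finset.sum_comm, Finset.sum_comm]
  have hle := Finset.sum_le_sum fun x (_ : x ∈ Finset.univ) =>
    Finset.sum_le_sum fun y (_ : y ∈ Finset.univ) =>
      Finset.sum_le_sum fun z (_ : z ∈ Finset.univ) => G.degreeKernel_symm_le x y z
  have hcount : ∑ x, ∑ y, ∑ z, (if {x, y, z} ∈ G.goodTriples then (1 : ℝ) else 0) ≤
      6 * ((G.T3 : ℝ) + G.I3) := by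
    have h := G.card_orderedGoodTriples_le
    rw [Finset.card_filter, Fintype.sum_prod_type] at h
    simp only [Fintype.sum_prod_type] at h
    exact_mod_cast h
  simp only [Finset.sum_add_distrib, Finset.sum_sub_distrib, ← Finset.mul_sum, hy, hz] at hle
  simp [-Finset.sum_boole] at hle
  linarith

end OrientedGraph

/-- For every ε > 0 there exists n₀ such that every oriented graph `G` on
`n ≥ n₀` vertices satisfies `t(G) + i(G) ≥ 1/10 − ε`. -/
theorem stmt_7 (ε : ℝ) (hε : 0 < ε) :
    ∃ n₀ : ℕ, 0 < n₀ ∧ ∀ n : ℕ, n₀ ≤ n → ∀ G : OrientedGraph (Fin n),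
      1 / 10 - ε ≤ G.tDens + G.iDens := by
  obtain ⟨m, hm⟩ := exists_nat_ge (5 / ε)
  refine ⟨m + 3, by omega, fun n hn G => ?_⟩
  have hn3 : 3 ≤ n := by omega
  have hmn : (m : ℝ) ≤ n := by exact_mod_cast (by omega : m ≤ n)
  have hεn : 5 ≤ ε * n := by
    have := (div_le_iff₀ hε).mp (hm.trans hmn)
    linarith
  have hcube := G.cube_le_T3_add_I3
  have hchoose : ((n.choose 3 : ℕ) : ℝ) ≤ (n : ℝ) ^ 3 / 6 := by
    simpa [Nat.factorial] using Nat.choose_le_pow_div (α := ℝ) 3 n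
  have hpos : (0 : ℝ) < (n.choose 3 : ℕ) := by exact_mod_cast Nat.choose_pos hn3
  rw [OrientedGraph.tDens, OrientedGraph.iDens, ← add_div]
  simp only [Fintype.card_fin] at hcube ⊢
  rw [le_div_iff₀ hpos]
  rcases le_total (1 / 10 - ε) 0 with h | h
  · exact (mul_nonpos_of_nonpos_of_nonneg h hpos.le).trans (by positivity)
  · have h₁ := mul_le_mul_of_nonneg_left hchoose h
    have h₂ := mul_le_mul_of_nonneg_right hεn (sq_nonneg (n : ℝ))
    nlinarith [sq_nonneg (n : ℝ)]
end

section
/- There exist δ > 0 and a positive integer n₀ such that every oriented graph G on n ≥ n₀ vertices satisfies t(G) + i(G) ≥ 1/10 + δ (equivalently, τ > 1/10, where τ = lim_{n→∞} τ(n)). -/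
open scoped Classical

section SymmetricSums

variable {V : Type} [Fintype V]

theorem sum_eq_zero_of_symmetrization_eq_zero (F : V → V → V → ℝ)
    (h : ∀ x y z, F x y z + F x z y + F y x z + F y z x + F z x y + F z y x = 0) :
    ∑ x, ∑ y, ∑ z, F x y z = 0 := by
  have swap_right (H : V → V → V → ℝ) :
      ∑ x, ∑ y, ∑ z, H x z y = ∑ x, ∑ y, ∑ z, H x y z :=
    Finset.sum_congr rfl fun x _ => Finset.sum_comm
  have swap_left (H : V → V → V → ℝ) :
      ∑ x, ∑ y, ∑ z, H y x z = ∑ x, ∑ y, ∑ z, H x y z :=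
    Finset.sum_comm
  have h₁ := swap_right F
  have h₂ := swap_left F
  have h₃ := (swap_left fun x y z => F x z y).trans h₁
  have h₄ := (swap_right fun x y z => F y x z).trans h₂
  have h₅ := (swap_right fun x y z => F y z x).trans h₃
  have key : ∑ x, ∑ y, ∑ z,
      (F x y z + F x z y + F y x z + F y z x + F z x y + F z y x) = 0 := by
    simp [h]
  simp only [Finset.sum_add_distrib] at key
  linarith

end SymmetricSums

/-- The `0`-`1` matrix of an oriented graph. -/
structure IsOrientedMatrix {V : Type} (A : V → V → ℝ) : Prop where
  zero_or_one : ∀ x y, A x y = 0 ∨ A x y = 1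
  mul_swap : ∀ x y, A x y * A y x = 0

/-- The indicator of the ordered triples `x → y → z` that do not close to a directed triangle. -/
def openPath {V : Type} (A : V → V → ℝ) (x y z : V) : ℝ :=
  A x y * A y z * (1 - A z x)

/-- The indicator of equality or non-adjacency. -/
def nonAdj {V : Type} (A : V → V → ℝ) (x y : V) : ℝ :=
  1 - A x y - A y x

/-- The number of open paths starting at `v` or having `v` as their middle vertex. -/
def openPathsAt {V : Type} [Fintype V] (A : V → V → ℝ) (v : V) : ℝ :=
  ∑ w, ∑ u, (openPath A v w u + openPath A u v w)

/-- How far the vertex `v` is from the local structure forced by density `1 / 10`. -/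
noncomputable def defect {V : Type} [Fintype V] (A : V → V → ℝ) (v : V) : ℝ :=
  (∑ w, A v w - ∑ w, A w v) ^ 2 +
    (∑ w, A v w + ∑ w, A w v - 3 / 5 * (Fintype.card V : ℝ)) ^ 2 + openPathsAt A v

namespace IsOrientedMatrix

variable {V : Type} {A : V → V → ℝ}

theorem pair_cases (hA : IsOrientedMatrix A) (x y : V) :
    (A x y = 0 ∧ A y x = 0) ∨ (A x y = 1 ∧ A y x = 0) ∨ (A x y = 0 ∧ A y x = 1) := by
  have h := hA.mul_swap x y
  rcases hA.zero_or_one x y with h₁ | h₁ <;> rcases hA.zero_or_one y x with h₂ | h₂ <;>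
    simp_all

theorem nonneg (hA : IsOrientedMatrix A) (x y : V) : 0 ≤ A x y := by
  rcases hA.zero_or_one x y with h | h <;> simp [h]

theorem le_one (hA : IsOrientedMatrix A) (x y : V) : A x y ≤ 1 := by
  rcases hA.zero_or_one x y with h | h <;> simp [h]

theorem openPath_nonneg (hA : IsOrientedMatrix A) (x y z : V) : 0 ≤ openPath A x y z :=
  mul_nonneg (mul_nonneg (hA.nonneg _ _) (hA.nonneg _ _)) (sub_nonneg.2 (hA.le_one _ _))

/-- The weight of a pair of vertices seen from a common centre, summing to a positive
semidefinite quadratic form in the degrees of the centre. -/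
noncomputable def centreWeight (A : V → V → ℝ) (x y z : V) : ℝ :=
  1 / 6 * ((A x y - A y x) * (A x z - A z x)) +
    5 / 6 * ((A x y + A y x - 3 / 5) * (A x z + A z x - 3 / 5))

variable [Fintype V]

theorem sum_centreWeight (A : V → V → ℝ) (x : V) :
    ∑ y, ∑ z, centreWeight A x y z = 1 / 6 * (∑ w, A x w - ∑ w, A w x) ^ 2 +
      5 / 6 * (∑ w, A x w + ∑ w, A w x - 3 / 5 * (Fintype.card V : ℝ)) ^ 2 := by
  simp only [centreWeight, Finset.sum_add_distrib, ← Finset.mul_sum, ← Finset.sum_mul,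
    Finset.sum_sub_distrib, Finset.sum_const, Finset.card_univ, nsmul_eq_mul]
  ring

theorem goodman_identity (hA : IsOrientedMatrix A) :
    6 * ∑ x, ∑ y, ∑ z, A x y * A y z * A x z +
        ∑ x, ∑ y, ∑ z, nonAdj A x y * nonAdj A y z * nonAdj A x z -
        1 / 10 * (Fintype.card V : ℝ) ^ 3 =
      3 * ∑ x, ∑ y, ∑ z, centreWeight A x y z + 2 * ∑ x, ∑ y, ∑ z, openPath A x y z := by
  have h := sum_eq_zero_of_symmetrization_eq_zero (fun x y z =>
    6 * (A x y * A y z * A x z) + nonAdj A x y * nonAdj A y z * nonAdj A x z - 1 / 10 -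
      3 * centreWeight A x y z - 2 * openPath A x y z) (by
    intro x y z
    rcases hA.pair_cases x y with ⟨h₁, h₂⟩ | ⟨h₁, h₂⟩ | ⟨h₁, h₂⟩ <;>
    rcases hA.pair_cases y z with ⟨h₃, h₄⟩ | ⟨h₃, h₄⟩ | ⟨h₃, h₄⟩ <;>
    rcases hA.pair_cases x z with ⟨h₅, h₆⟩ | ⟨h₅, h₆⟩ | ⟨h₅, h₆⟩ <;>
    simp only [nonAdj, centreWeight, openPath, h₁, h₂, h₃, h₄, h₅, h₆] <;> norm_num)
  simp only [Finset.sum_add_distrib, Finset.sum_sub_distrib, ← Finset.mul_sum,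
    Finset.sum_const, Finset.card_univ, nsmul_eq_mul] at h
  linarith

theorem sum_openPathsAt (A : V → V → ℝ) :
    ∑ v, openPathsAt A v = 2 * ∑ x, ∑ y, ∑ z, openPath A x y z := by
  have h : ∑ v, ∑ w, ∑ u, openPath A u v w = ∑ x, ∑ y, ∑ z, openPath A x y z := by
    exact (Finset.sum_congr rfl fun _ _ => Finset.sum_comm).trans Finset.sum_comm
  simp only [openPathsAt, Finset.sum_add_distrib, h]
  ring

theorem openPathsAt_nonneg (hA : IsOrientedMatrix A) (v : V) : 0 ≤ openPathsAt A v :=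
  Finset.sum_nonneg fun _ _ => Finset.sum_nonneg fun _ _ =>
    add_nonneg (hA.openPath_nonneg _ _ _) (hA.openPath_nonneg _ _ _)

theorem sum_defect_le (hA : IsOrientedMatrix A) {ε : ℝ}
    (h : 6 * ∑ x, ∑ y, ∑ z, A x y * A y z * A x z +
        ∑ x, ∑ y, ∑ z, nonAdj A x y * nonAdj A y z * nonAdj A x z ≤
      1 / 10 * (Fintype.card V : ℝ) ^ 3 + ε) :
    ∑ v, defect A v ≤ 2 * ε := by
  have h₁ := hA.goodman_identity
  have h₂ := sum_openPathsAt A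
  simp only [sum_centreWeight, Finset.sum_add_distrib, ← Finset.mul_sum] at h₁
  simp only [defect, Finset.sum_add_distrib]
  have h₃ : 0 ≤ ∑ v, openPathsAt A v := Finset.sum_nonneg fun v _ => hA.openPathsAt_nonneg v
  have h₄ : 0 ≤ ∑ x, (∑ w, A x w + ∑ w, A w x - 3 / 5 * (Fintype.card V : ℝ)) ^ 2 :=
    Finset.sum_nonneg fun _ _ => sq_nonneg _
  linarith

/-- Common out-neighbours force common in-neighbours, up to open paths. -/
theorem common_out_mul_le (hA : IsOrientedMatrix A) (x y : V) :
    (∑ w, A x w * A y w) * (∑ u, A u x - ∑ u, A u x * A u y) ≤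
      openPathsAt A x + openPathsAt A y := by
  rw [← Finset.sum_sub_distrib, Finset.sum_mul_sum, openPathsAt, openPathsAt,
    ← Finset.sum_add_distrib]
  refine Finset.sum_le_sum fun w _ => ?_
  rw [← Finset.sum_add_distrib]
  refine Finset.sum_le_sum fun u _ => ?_
  have h₁ := hA.openPath_nonneg x w u
  have h₂ := hA.openPath_nonneg u y w
  have h₃ : A x w * A y w * (A u x - A u x * A u y) ≤
      openPath A u x w + openPath A y w u := by
    unfold openPath
    rcases hA.zero_or_one x w with a | a <;> rcases hA.zero_or_one y w with b | b <;>
    rcases hA.zero_or_one u x with c | c <;> rcases hA.zero_or_one u y with d | d <;>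
    rcases hA.zero_or_one w u with e | e <;> norm_num [a, b, c, d, e]
  linarith

theorem out_bonferroni (hA : IsOrientedMatrix A) (a b c d : V) :
    ∑ w, A a w + ∑ w, A b w + ∑ w, A c w + ∑ w, A d w ≤
      (Fintype.card V : ℝ) + (∑ w, A a w * A b w + ∑ w, A a w * A c w + ∑ w, A a w * A d w +
        ∑ w, A b w * A c w + ∑ w, A b w * A d w + ∑ w, A c w * A d w) := by
  have hcard : (Fintype.card V : ℝ) = ∑ _w : V, (1 : ℝ) := by simp
  rw [hcard]
  simp only [← Finset.sum_add_distrib]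
  refine Finset.sum_le_sum fun w _ => ?_
  rcases hA.zero_or_one a w with h₁ | h₁ <;> rcases hA.zero_or_one b w with h₂ | h₂ <;>
  rcases hA.zero_or_one c w with h₃ | h₃ <;> rcases hA.zero_or_one d w with h₄ | h₄ <;>
  norm_num [h₁, h₂, h₃, h₄]

theorem degrees_of_defect_le (hA : IsOrientedMatrix A) {v : V}
    (hv : defect A v ≤ (Fintype.card V : ℝ) ^ 2 / 1000000) :
    |∑ w, A v w - 3 / 10 * (Fintype.card V : ℝ)| ≤ (Fintype.card V : ℝ) / 1000 ∧
      |∑ w, A w v - 3 / 10 * (Fintype.card V : ℝ)| ≤ (Fintype.card V : ℝ) / 1000 ∧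
      openPathsAt A v ≤ (Fintype.card V : ℝ) ^ 2 / 1000000 := by
  have h₀ := hA.openPathsAt_nonneg v
  unfold defect at hv
  generalize (∑ w, A v w) = p at *
  generalize (∑ w, A w v) = q at *
  have hn : (0 : ℝ) ≤ Fintype.card V := Nat.cast_nonneg _
  generalize (Fintype.card V : ℝ) = n at *
  have h₁ : |p - q| ≤ n / 1000 :=
    abs_le_of_sq_le_sq (by nlinarith [sq_nonneg (p + q - 3 / 5 * n)]) (by positivity)
  have h₂ : |p + q - 3 / 5 * n| ≤ n / 1000 :=
    abs_le_of_sq_le_sq (by nlinarith [sq_nonneg (p - q)]) (by positivity)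
  rw [abs_le] at h₁ h₂
  refine ⟨abs_le.2 ⟨by linarith, by linarith⟩, abs_le.2 ⟨by linarith, by linarith⟩, ?_⟩
  nlinarith [sq_nonneg (p - q), sq_nonneg (p + q - 3 / 5 * n)]

theorem defect_nonneg (hA : IsOrientedMatrix A) (v : V) : 0 ≤ defect A v :=
  add_nonneg (add_nonneg (sq_nonneg _) (sq_nonneg _)) (hA.openPathsAt_nonneg v)

/-- The vertices of large defect. -/
noncomputable def irregular (A : V → V → ℝ) : Finset V :=
  {v | (Fintype.card V : ℝ) ^ 2 / 1000000 < defect A v}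

theorem card_irregular_le (hA : IsOrientedMatrix A)
    (h : ∑ v, defect A v ≤ (Fintype.card V : ℝ) ^ 3 / 1000000000) :
    ((irregular A).card : ℝ) ≤ (Fintype.card V : ℝ) / 1000 := by
  rcases (Nat.cast_nonneg (α := ℝ) (Fintype.card V)).eq_or_lt with h₀ | h₀
  · have : Fintype.card V = 0 := by exact_mod_cast h₀.symm
    have h₁ : (irregular A).card ≤ Fintype.card V := Finset.card_le_univ _
    have h₂ : (irregular A).card = 0 := by omega
    simp [this, h₂]
  have h₁ : ((irregular A).card : ℝ) * ((Fintype.card V : ℝ) ^ 2 / 1000000) ≤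
      ∑ v, defect A v := by
    rw [← nsmul_eq_mul]
    refine (Finset.card_nsmul_le_sum _ _ _ fun v hv => ?_).trans
      (Finset.sum_le_univ_sum_of_nonneg fun v => hA.defect_nonneg v)
    exact (Finset.mem_filter.1 hv).2.le
  have h₂ : (0 : ℝ) < (Fintype.card V : ℝ) ^ 2 / 1000000 := by positivity
  refine le_of_mul_le_mul_right (h₁.trans (h.trans_eq ?_)) h₂
  ring

/-- The vertices that are irregular or share many out-neighbours with `x`. -/
noncomputable def related (A : V → V → ℝ) (x : V) : Finset V :=
  irregular A ∪ ({y | (Fintype.card V : ℝ) / 50 ≤ ∑ w, A x w * A y w} : Finset V)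

theorem sum_common_in_le (hA : IsOrientedMatrix A)
    (h : ((irregular A).card : ℝ) ≤ (Fintype.card V : ℝ) / 1000) {x : V}
    (hx : x ∉ irregular A) :
    ∑ y, ∑ u, A u x * A u y ≤ 917 / 10000 * (Fintype.card V : ℝ) ^ 2 := by
  have hn : (0 : ℝ) ≤ Fintype.card V := Nat.cast_nonneg _
  obtain ⟨-, hq, -⟩ := hA.degrees_of_defect_le (v := x) (by simpa [irregular] using hx)
  rw [Finset.sum_comm]
  simp only [← Finset.mul_sum]
  have h₁ (u : V) : A u x * ∑ y, A u y ≤ A u x * (301 / 1000 * (Fintype.card V : ℝ)) +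
      if u ∈ irregular A then (Fintype.card V : ℝ) else 0 := by
    have ha := hA.nonneg u x
    split_ifs with hu
    · have h₂ : ∑ y, A u y ≤ (Fintype.card V : ℝ) := by
        simpa using Finset.sum_le_sum fun y (_ : y ∈ Finset.univ) => hA.le_one u y
      have h₃ : 0 ≤ ∑ y, A u y := Finset.sum_nonneg fun y _ => hA.nonneg u y
      have h₄ : A u x * ∑ y, A u y ≤ ∑ y, A u y :=
        mul_le_of_le_one_left h₃ (hA.le_one u x)
      have h₅ : 0 ≤ A u x * (301 / 1000 * (Fintype.card V : ℝ)) := by positivity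
      linarith
    · obtain ⟨hp, -, -⟩ := hA.degrees_of_defect_le (v := u) (by simpa [irregular] using hu)
      rw [add_zero]
      refine mul_le_mul_of_nonneg_left ?_ ha
      linarith [(abs_le.1 hp).2]
  refine (Finset.sum_le_sum fun u _ => h₁ u).trans ?_
  rw [Finset.sum_add_distrib, ← Finset.sum_mul, Finset.sum_ite_mem, Finset.univ_inter,
    Finset.sum_const, nsmul_eq_mul]
  have h₂ := (abs_le.1 hq).2
  have h₃ : ∑ u, A u x ≤ 301 / 1000 * (Fintype.card V : ℝ) := by linarith
  nlinarith [mul_le_mul_of_nonneg_right h₃ hn, mul_le_mul_of_nonneg_right h hn]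

theorem card_related_lt (hA : IsOrientedMatrix A) (hV : 0 < Fintype.card V)
    (h : ((irregular A).card : ℝ) ≤ (Fintype.card V : ℝ) / 1000) {x : V}
    (hx : x ∉ irregular A) : 3 * (related A x).card < Fintype.card V := by
  have hn : (0 : ℝ) < Fintype.card V := Nat.cast_pos.2 hV
  obtain ⟨-, hq, hL⟩ := hA.degrees_of_defect_le (v := x) (by simpa [irregular] using hx)
  have h₁ : ((related A x \ irregular A).card : ℝ) * (298 / 1000 * (Fintype.card V : ℝ)) ≤
      ∑ y, ∑ u, A u x * A u y := by
    rw [← nsmul_eq_mul]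
    refine (Finset.card_nsmul_le_sum _ _ _ fun y hy => ?_).trans
      (Finset.sum_le_univ_sum_of_nonneg fun y =>
        Finset.sum_nonneg fun u _ => mul_nonneg (hA.nonneg _ _) (hA.nonneg _ _))
    obtain ⟨hy₁, hy₂⟩ := Finset.mem_sdiff.1 hy
    obtain ⟨-, -, hLy⟩ := hA.degrees_of_defect_le (v := y) (by simpa [irregular] using hy₂)
    have hc : (Fintype.card V : ℝ) / 50 ≤ ∑ w, A x w * A y w := by
      rcases Finset.mem_union.1 hy₁ with h' | h'
      · exact absurd h' hy₂
      · exact (Finset.mem_filter.1 h').2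
    have hm := hA.common_out_mul_le x y
    have hd := (abs_le.1 hq).1
    by_contra! hlt
    have hgap : (Fintype.card V : ℝ) / 1000 ≤ ∑ u, A u x - ∑ u, A u x * A u y := by linarith
    have := mul_le_mul hc hgap (by positivity) (le_trans (by positivity) hc)
    nlinarith [mul_pos hn hn]
  have h₂ := h₁.trans (hA.sum_common_in_le h hx)
  have h₃ : ((related A x \ irregular A).card : ℝ) ≤ 31 / 100 * (Fintype.card V : ℝ) := by
    by_contra! hlt
    nlinarith [mul_lt_mul_of_pos_right hlt hn, mul_pos hn hn]
  have h₄ : (related A x).card ≤ (related A x \ irregular A).card + (irregular A).card :=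
    (Finset.card_le_card (by simp)).trans (Finset.card_union_le _ _)
  have h₅ : ((related A x).card : ℝ) ≤
      ((related A x \ irregular A).card : ℝ) + ((irregular A).card : ℝ) := by exact_mod_cast h₄
  have h₆ : 3 * ((related A x).card : ℝ) < Fintype.card V := by linarith
  exact_mod_cast h₆

theorem exists_notMem_of_card_lt {s : Finset V} (h : s.card < Fintype.card V) :
    ∃ x, x ∉ s := by
  by_contra! hs
  exact h.ne (by rw [Finset.eq_univ_of_forall hs, Finset.card_univ])

theorem lt_sum_defect (hA : IsOrientedMatrix A) (hV : 0 < Fintype.card V) :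
    (Fintype.card V : ℝ) ^ 3 / 1000000000 < ∑ v, defect A v := by
  by_contra! h
  have hn : (0 : ℝ) < Fintype.card V := Nat.cast_pos.2 hV
  have hI := hA.card_irregular_le h
  have hI' : (irregular A).card < Fintype.card V := by
    have : ((irregular A).card : ℝ) < Fintype.card V := by linarith
    exact_mod_cast this
  have of_notMem {x y : V} (hy : y ∉ related A x) :
      y ∉ irregular A ∧ ∑ w, A x w * A y w ≤ (Fintype.card V : ℝ) / 50 := by
    simp only [related, Finset.mem_union, not_or, Finset.mem_filter, Finset.mem_univ, true_and,
      not_le] at hy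
    exact ⟨hy.1, hy.2.le⟩
  have out_ge {x : V} (hx : x ∉ irregular A) :
      299 / 1000 * (Fintype.card V : ℝ) ≤ ∑ w, A x w := by
    obtain ⟨hp, -, -⟩ := hA.degrees_of_defect_le (v := x) (by simpa [irregular] using hx)
    linarith [(abs_le.1 hp).1]
  obtain ⟨a, ha⟩ := exists_notMem_of_card_lt hI'
  have ra := hA.card_related_lt hV hI ha
  obtain ⟨b, hb⟩ := exists_notMem_of_card_lt (s := related A a) (by omega)
  obtain ⟨hb, hab⟩ := of_notMem hb
  have rb := hA.card_related_lt hV hI hb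
  have cab := Finset.card_union_le (related A a) (related A b)
  obtain ⟨c, hc⟩ := exists_notMem_of_card_lt (s := related A a ∪ related A b) (by omega)
  rw [Finset.mem_union, not_or] at hc
  obtain ⟨-, hbc⟩ := of_notMem hc.2
  obtain ⟨hc, hac⟩ := of_notMem hc.1
  have rc := hA.card_related_lt hV hI hc
  have cabc := Finset.card_union_le (related A a ∪ related A b) (related A c)
  obtain ⟨d, hd⟩ :=
    exists_notMem_of_card_lt (s := related A a ∪ related A b ∪ related A c) (by omega)
  simp only [Finset.mem_union, not_or] at hd
  obtain ⟨hd', had⟩ := of_notMem hd.1.1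
  obtain ⟨-, hbd⟩ := of_notMem hd.1.2
  obtain ⟨-, hcd⟩ := of_notMem hd.2
  linarith [hA.out_bonferroni a b c d, out_ge ha, out_ge hb, out_ge hc, out_ge hd']

theorem lt_triple_sums (hA : IsOrientedMatrix A) (hV : 0 < Fintype.card V) :
    (1 / 10 + 1 / 2000000000) * (Fintype.card V : ℝ) ^ 3 <
      6 * ∑ x, ∑ y, ∑ z, A x y * A y z * A x z +
        ∑ x, ∑ y, ∑ z, nonAdj A x y * nonAdj A y z * nonAdj A x z := by
  by_contra! h
  have h₁ := hA.sum_defect_le (ε := 1 / 2000000000 * (Fintype.card V : ℝ) ^ 3)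
    (h.trans_eq (by ring))
  linarith [hA.lt_sum_defect hV]

end IsOrientedMatrix

namespace OrientedGraph

variable {V : Type} [Fintype V] [DecidableEq V]

/-- The real adjacency matrix of an oriented graph. -/
noncomputable def matrix (G : OrientedGraph V) (x y : V) : ℝ :=
  if G.adj x y then 1 else 0

theorem isOrientedMatrix (G : OrientedGraph V) : IsOrientedMatrix G.matrix where
  zero_or_one x y := by
    unfold matrix
    split_ifs <;> simp
  mul_swap x y := by
    have := G.asymm x y
    unfold matrix
    split_ifs <;> simp_all

theorem adj_irrefl (G : OrientedGraph V) (x : V) : ¬ G.adj x x :=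
  fun h => G.asymm x x h h

omit [DecidableEq V] in
theorem sum_indicator_eq_card (P : V → V → V → Prop) [∀ x y z, Decidable (P x y z)] :
    ∑ x, ∑ y, ∑ z, (if P x y z then (1 : ℝ) else 0) =
      ((Finset.univ.filter fun p : V × V × V => P p.1 p.2.1 p.2.2).card : ℝ) := by
  rw [Finset.card_filter, Nat.cast_sum, Fintype.sum_prod_type]
  simp only [Fintype.sum_prod_type]
  simp

theorem sum_transitive_le (G : OrientedGraph V) :
    ∑ x, ∑ y, ∑ z, G.matrix x y * G.matrix y z * G.matrix x z ≤ (G.T3 : ℝ) := by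
  have h (x y z : V) : G.matrix x y * G.matrix y z * G.matrix x z =
      if G.adj x y ∧ G.adj y z ∧ G.adj x z then 1 else 0 := by
    unfold matrix
    split_ifs <;> simp_all
  simp only [h]
  rw [sum_indicator_eq_card fun x y z => G.adj x y ∧ G.adj y z ∧ G.adj x z, Nat.cast_le, T3]
  refine Finset.card_le_card_of_injOn (fun p => {p.1, p.2.1, p.2.2}) ?_ ?_
  · rintro ⟨x, y, z⟩ hp
    simp only [Finset.coe_filter, Finset.mem_univ, true_and, Set.mem_ofPred_eq] at hp
    obtain ⟨h₁, h₂, h₃⟩ := hp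
    have hxy : x ≠ y := fun e => G.adj_irrefl y (e ▸ h₁)
    have hyz : y ≠ z := fun e => G.adj_irrefl z (e ▸ h₂)
    have hxz : x ≠ z := fun e => G.adj_irrefl z (e ▸ h₃)
    simp only [Finset.coe_filter, Finset.mem_powersetCard, Finset.subset_univ, true_and,
      Set.mem_ofPred_eq]
    exact ⟨Finset.card_eq_three.2 ⟨x, y, z, hxy, hxz, hyz, rfl⟩, x, y, z, rfl, h₁, h₂, h₃⟩
  · rintro ⟨x, y, z⟩ hp ⟨x', y', z'⟩ hp' he
    simp only [Finset.coe_filter, Finset.mem_univ, true_and, Set.mem_ofPred_eq] at hp hp' he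
    have hx : x ∈ ({x', y', z'} : Finset V) := he ▸ by simp
    have hy : y ∈ ({x', y', z'} : Finset V) := he ▸ by simp
    have hz : z ∈ ({x', y', z'} : Finset V) := he ▸ by simp
    simp only [Finset.mem_insert, Finset.mem_singleton] at hx hy hz
    have hirr := G.adj_irrefl
    have hasym := G.asymm
    obtain ⟨h₁, h₂, h₃⟩ := hp
    obtain ⟨h₄, h₅, h₆⟩ := hp'
    rcases hx with rfl | rfl | rfl <;> rcases hy with rfl | rfl | rfl <;>
      rcases hz with rfl | rfl | rfl <;> grind

/-- Ordered triples of distinct, pairwise non-adjacent vertices. -/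
noncomputable def indepTriples (G : OrientedGraph V) : Finset (V × V × V) :=
  {p | p.1 ≠ p.2.1 ∧ p.2.1 ≠ p.2.2 ∧ p.1 ≠ p.2.2 ∧ G.isIndep {p.1, p.2.1, p.2.2}}

theorem card_indepTriples_le (G : OrientedGraph V) : G.indepTriples.card ≤ 6 * G.I3 := by
  refine Finset.card_le_mul_card_image_of_maps_to
    (f := fun p : V × V × V => ({p.1, p.2.1, p.2.2} : Finset V)) ?_ 6 ?_
  · rintro ⟨x, y, z⟩ hp
    simp only [indepTriples, Finset.mem_filter, Finset.mem_univ, true_and] at hp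
    obtain ⟨hxy, hyz, hxz, hi⟩ := hp
    simp only [Finset.mem_filter, Finset.mem_powersetCard, Finset.subset_univ, true_and]
    exact ⟨Finset.card_eq_three.2 ⟨x, y, z, hxy, hxz, hyz, rfl⟩, hi⟩
  · intro s hs
    simp only [Finset.mem_filter, Finset.mem_powersetCard, Finset.subset_univ, true_and] at hs
    obtain ⟨a, b, c, hab, hac, hbc, rfl⟩ := Finset.card_eq_three.1 hs.1
    refine (Finset.card_le_card (t := {(a, b, c), (a, c, b), (b, a, c), (b, c, a), (c, a, b),
      (c, b, a)}) ?_).trans Finset.card_le_six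
    rintro ⟨x, y, z⟩ hp
    simp only [indepTriples, Finset.mem_filter, Finset.mem_univ, true_and] at hp
    obtain ⟨⟨hxy, hyz, hxz, -⟩, he⟩ := hp
    have hx : x ∈ ({a, b, c} : Finset V) := he ▸ by simp
    have hy : y ∈ ({a, b, c} : Finset V) := he ▸ by simp
    have hz : z ∈ ({a, b, c} : Finset V) := he ▸ by simp
    simp only [Finset.mem_insert, Finset.mem_singleton] at hx hy hz
    simp only [Finset.mem_insert, Finset.mem_singleton, Prod.mk.injEq]
    grind

theorem nonAdj_triple_le (G : OrientedGraph V) (x y z : V) :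
    nonAdj G.matrix x y * nonAdj G.matrix y z * nonAdj G.matrix x z ≤
      (if (x, y, z) ∈ G.indepTriples then 1 else 0) +
        ((if x = y then 1 else 0) + (if y = z then 1 else 0) + if x = z then 1 else 0) := by
  have hle (u v : V) : nonAdj G.matrix u v = 0 ∨
      (nonAdj G.matrix u v = 1 ∧ ¬ G.adj u v ∧ ¬ G.adj v u) := by
    have := G.asymm u v
    unfold nonAdj matrix
    split_ifs <;> simp_all
  have hpos : (0 : ℝ) ≤ (if (x, y, z) ∈ G.indepTriples then 1 else 0) +
      ((if x = y then 1 else 0) + (if y = z then 1 else 0) + if x = z then 1 else 0) := by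
    positivity
  rcases hle x y with h₁ | ⟨h₁, a₁, b₁⟩
  · simpa [h₁] using hpos
  rcases hle y z with h₂ | ⟨h₂, a₂, b₂⟩
  · simpa [h₂] using hpos
  rcases hle x z with h₃ | ⟨h₃, a₃, b₃⟩
  · simpa [h₃] using hpos
  rw [h₁, h₂, h₃]
  by_cases hxy : x = y
  · rw [if_pos hxy]
    split_ifs <;> norm_num
  by_cases hyz : y = z
  · rw [if_pos hyz]
    split_ifs <;> norm_num
  by_cases hxz : x = z
  · rw [if_pos hxz]
    split_ifs <;> norm_num
  have hi : (x, y, z) ∈ G.indepTriples := by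
    have hirr := G.adj_irrefl
    simp only [indepTriples, Finset.mem_filter, Finset.mem_univ, true_and]
    refine ⟨hxy, hyz, hxz, ?_⟩
    intro u hu v hv
    simp only [Finset.mem_insert, Finset.mem_singleton] at hu hv
    rcases hu with rfl | rfl | rfl <;> rcases hv with rfl | rfl | rfl <;> simp_all
  simp [hi, hxy, hyz, hxz]

theorem sum_nonAdj_le (G : OrientedGraph V) :
    ∑ x, ∑ y, ∑ z, nonAdj G.matrix x y * nonAdj G.matrix y z * nonAdj G.matrix x z ≤
      6 * (G.I3 : ℝ) + 3 * (Fintype.card V : ℝ) ^ 2 := by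
  have h₁ : ∑ x, ∑ y, ∑ z, (if (x, y, z) ∈ G.indepTriples then (1 : ℝ) else 0) ≤
      6 * (G.I3 : ℝ) := by
    rw [sum_indicator_eq_card fun x y z => (x, y, z) ∈ G.indepTriples]
    simp only [Prod.mk.eta, Finset.filter_univ_mem]
    exact_mod_cast G.card_indepTriples_le
  refine (Finset.sum_le_sum fun x _ => Finset.sum_le_sum fun y _ => Finset.sum_le_sum fun z _ =>
    G.nonAdj_triple_le x y z).trans ?_
  simp only [Finset.sum_add_distrib]
  refine add_le_add h₁ (le_of_eq ?_)
  simp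
  ring

theorem tDens_add_iDens_ge (G : OrientedGraph V) (hV : 3 ≤ Fintype.card V) :
    1 / 10 + 1 / 2000000000 - 3 / (Fintype.card V : ℝ) ≤ G.tDens + G.iDens := by
  have hn : (0 : ℝ) < Fintype.card V := Nat.cast_pos.2 (by omega)
  have hC : (0 : ℝ) < ((Fintype.card V).choose 3 : ℝ) := Nat.cast_pos.2 (Nat.choose_pos hV)
  have hC' : 6 * ((Fintype.card V).choose 3 : ℝ) ≤ (Fintype.card V : ℝ) ^ 3 := by
    have := Nat.choose_le_pow_div (α := ℝ) 3 (Fintype.card V)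
    norm_num [Nat.factorial] at this
    linarith
  have h₁ := G.isOrientedMatrix.lt_triple_sums (by omega)
  have h₂ := G.sum_transitive_le
  have h₃ := G.sum_nonAdj_le
  have h₄ : (1 / 10 + 1 / 2000000000 - 3 / (Fintype.card V : ℝ)) * (Fintype.card V : ℝ) ^ 3 ≤
      6 * ((G.T3 : ℝ) + G.I3) := by
    have : 3 / (Fintype.card V : ℝ) * (Fintype.card V : ℝ) ^ 3 = 3 * (Fintype.card V : ℝ) ^ 2 := by
      field_simp
    rw [sub_mul, this]
    linarith
  rw [tDens, iDens, ← add_div]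
  calc _ ≤ 6 * ((G.T3 : ℝ) + G.I3) / (Fintype.card V : ℝ) ^ 3 := by
        rwa [le_div_iff₀ (by positivity)]
    _ ≤ 6 * ((G.T3 : ℝ) + G.I3) / (6 * ((Fintype.card V).choose 3 : ℝ)) := by gcongr
    _ = _ := by rw [mul_div_mul_left _ _ (by norm_num)]

end OrientedGraph

/-- τ > 1/10: there exist δ > 0 and n₀ such that every oriented graph `G` on
`n ≥ n₀` vertices satisfies `t(G) + i(G) ≥ 1/10 + δ`. -/
theorem stmt_10 :
    ∃ (δ : ℝ) (n₀ : ℕ), 0 < δ ∧ 0 < n₀ ∧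
      ∀ n : ℕ, n₀ ≤ n → ∀ G : OrientedGraph (Fin n),
        1 / 10 + δ ≤ G.tDens + G.iDens := by
  refine ⟨1 / 4000000000, 12000000000, by norm_num, by norm_num, fun n hn G => ?_⟩
  have h := G.tDens_add_iDens_ge (by rw [Fintype.card_fin]; omega)
  rw [Fintype.card_fin] at h
  have hn' : (12000000000 : ℝ) ≤ n := by exact_mod_cast hn
  have h' : 3 / (n : ℝ) ≤ 1 / 4000000000 := by
    rw [div_le_div_iff₀ (by linarith) (by norm_num)]
    linarith
  linarith
end

section
/- There is a positive constant C such that for every δ > 0 there is a positive integer n₁ for which the following holds: if G is an oriented graph on n ≥ n₁ vertices with t(G) + i(G) ≤ 1/9 + δ, and G⁽⁰⁾ is the underlying undirected graph of G, then p(K₄, G⁽⁰⁾) ≤ C·δ. -/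
open scoped Classical

namespace OrientedGraph

variable {V : Type} [Fintype V] [DecidableEq V]

/-- The number of 4-element vertex sets inducing a complete graph in the
underlying undirected graph of `G` (two vertices being adjacent iff they are
joined by an edge in either direction in `G`). -/
noncomputable def K4Count (G : OrientedGraph V) : ℕ :=
  ((Finset.univ.powersetCard 4 : Finset (Finset V)).filter
    (fun s => ∀ x ∈ s, ∀ y ∈ s, x ≠ y → (G.adj x y ∨ G.adj y x))).card

/-- `p(K₄, G⁽⁰⁾)`: the probability that a uniformly random 4-element vertex
set induces a complete graph in the underlying undirected graph of `G`. -/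
noncomputable def K4Dens (G : OrientedGraph V) : ℝ :=
  (G.K4Count : ℝ) / ((Fintype.card V).choose 4 : ℝ)

end OrientedGraph

namespace OrientedGraph

/-- The indicator that three vertices `x, y, z` are independent or span a transitive triangle,
in terms of the orientations of `xy`, `xz` and `yz`. -/
def indepOrTrans : SignType → SignType → SignType → ℤ
  | .zero, .zero, .zero => 1
  | .pos, .pos, .pos | .pos, .pos, .neg | .pos, .neg, .neg => 1
  | .neg, .neg, .neg | .neg, .neg, .pos | .neg, .pos, .pos => 1
  | _, _, _ => 0

/-- The indicator that a pair is adjacent, in terms of its orientation. -/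
def isAdj : SignType → ℤ
  | .zero => 0
  | _ => 1

/-! For a pair `u, v`, the following functions depend on the orientations of `uw` and `vw`.
Their sums over `w` are the linear forms of the sum-of-squares certificate: the first three
are used when `u, v` are not adjacent, the other five when `u → v`. -/

def nonadjFlag₁ : SignType → SignType → ℤ
  | .pos, .pos | .neg, .neg => 1
  | .zero, .zero => -2
  | _, _ => 0

def nonadjFlag₂ : SignType → SignType → ℤ
  | .pos, .zero | .zero, .pos => 1
  | .neg, .zero | .zero, .neg => -1
  | _, _ => 0

def nonadjFlag₃ : SignType → SignType → ℤ
  | .pos, .zero | .neg, .zero => 1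
  | .zero, .pos | .zero, .neg => -1
  | _, _ => 0

def arcFlag₁ : SignType → SignType → ℤ
  | .neg, .pos => 2
  | .neg, .zero | .zero, .pos => 1
  | .pos, .zero | .zero, .neg | .zero, .zero => -1
  | _, _ => 0

def arcFlag₂ : SignType → SignType → ℤ
  | .zero, .zero => 6
  | .neg, .zero | .zero, .pos => -3
  | .pos, .pos | .neg, .neg => -7
  | _, _ => 0

def arcFlag₃ : SignType → SignType → ℤ
  | .neg, .zero | .zero, .pos => 2
  | .pos, .pos | .neg, .neg => -3
  | _, _ => 0

def arcFlag₄ : SignType → SignType → ℤ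
  | .pos, .zero => 1
  | .zero, .neg => -1
  | _, _ => 0

def arcFlag₅ : SignType → SignType → ℤ
  | .neg, .zero => 1
  | .zero, .pos => -1
  | _, _ => 0

/-- The kernel of the sum-of-squares certificate, for an ordered pair with orientation `p` and
two further vertices attached to the pair as described by `a, b` and `a', b'`. -/
def squareKernel (p a b a' b' : SignType) : ℤ :=
  match p with
  | .zero => 8 * (nonadjFlag₁ a b * nonadjFlag₁ a' b') +
      11 * (nonadjFlag₂ a b * nonadjFlag₂ a' b') + 19 * (nonadjFlag₃ a b * nonadjFlag₃ a' b')
  | .pos => 16 * (arcFlag₁ a b * arcFlag₁ a' b') + 1 * (arcFlag₂ a b * arcFlag₂ a' b') +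
      4 * (arcFlag₃ a b * arcFlag₃ a' b') + 36 * (arcFlag₄ a b * arcFlag₄ a' b') +
      53 * (arcFlag₅ a b * arcFlag₅ a' b')
  | .neg => 0

/-- The weight of an ordered quadruple of vertices with the given orientations of its pairs
`01`, `02`, `03`, `12`, `13`, `23`. -/
def quadWeight (a b c d e f : SignType) : ℤ :=
  36 * indepOrTrans a b d - 4 - isAdj a * isAdj b * isAdj c * isAdj d * isAdj e * isAdj f -
    squareKernel a b d c e

/-- The weight is nonnegative after symmetrization over the orderings of the quadruple. -/
theorem quadWeight_symm_nonneg : ∀ a b c d e f : SignType,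
    0 ≤ quadWeight a b c d e f +
      quadWeight a c b e d (-f) +
      quadWeight b a c (-d) f e +
      quadWeight b c a f (-d) (-e) +
      quadWeight c b a (-f) (-e) (-d) +
      quadWeight c a b (-e) (-f) d +
      quadWeight (-a) d e b c f +
      quadWeight (-a) e d c b (-f) +
      quadWeight d (-a) e (-b) f c +
      quadWeight d e (-a) f (-b) (-c) +
      quadWeight e d (-a) (-f) (-c) (-b) +
      quadWeight e (-a) d (-c) (-f) b +
      quadWeight (-d) (-b) f (-a) e c +
      quadWeight (-d) f (-b) e (-a) (-c) +
      quadWeight (-b) (-d) f a c e +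
      quadWeight (-b) f (-d) c a (-e) +
      quadWeight f (-b) (-d) (-c) (-e) a +
      quadWeight f (-d) (-b) (-e) (-c) (-a) +
      quadWeight (-e) (-f) (-c) d (-a) (-b) +
      quadWeight (-e) (-c) (-f) (-a) d b +
      quadWeight (-f) (-e) (-c) (-d) (-b) (-a) +
      quadWeight (-f) (-c) (-e) (-b) (-d) a +
      quadWeight (-c) (-f) (-e) b a (-d) +
      quadWeight (-c) (-e) (-f) a b d := by
  decide +kernel

theorem sum_perm_fin_four (g : Fin 4 → Fin 4 → Fin 4 → Fin 4 → ℤ) :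
    ∑ σ : Equiv.Perm (Fin 4), g (σ 0) (σ 1) (σ 2) (σ 3) =
      g 0 1 2 3 + g 0 1 3 2 + g 0 2 1 3 + g 0 2 3 1 + g 0 3 2 1 + g 0 3 1 2 +
      g 1 0 2 3 + g 1 0 3 2 + g 1 2 0 3 + g 1 2 3 0 + g 1 3 2 0 + g 1 3 0 2 +
      g 2 1 0 3 + g 2 1 3 0 + g 2 0 1 3 + g 2 0 3 1 + g 2 3 0 1 + g 2 3 1 0 +
      g 3 1 2 0 + g 3 1 0 2 + g 3 2 1 0 + g 3 2 0 1 + g 3 0 2 1 + g 3 0 1 2 := by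
  have h : (Finset.univ : Finset (Equiv.Perm (Fin 4))).val.map
      (fun σ ↦ (σ 0, σ 1, σ 2, σ 3)) =
      ↑([(0, 1, 2, 3), (0, 1, 3, 2), (0, 2, 1, 3), (0, 2, 3, 1), (0, 3, 2, 1), (0, 3, 1, 2),
        (1, 0, 2, 3), (1, 0, 3, 2), (1, 2, 0, 3), (1, 2, 3, 0), (1, 3, 2, 0), (1, 3, 0, 2),
        (2, 1, 0, 3), (2, 1, 3, 0), (2, 0, 1, 3), (2, 0, 3, 1), (2, 3, 0, 1), (2, 3, 1, 0),
        (3, 1, 2, 0), (3, 1, 0, 2), (3, 2, 1, 0), (3, 2, 0, 1), (3, 0, 2, 1), (3, 0, 1, 2)] :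
        List (Fin 4 × Fin 4 × Fin 4 × Fin 4)) := by
    decide +kernel
  have h' := congrArg (fun m ↦ (m.map fun q ↦ g q.1 q.2.1 q.2.2.1 q.2.2.2).sum) h
  simp only [Multiset.map_map, Function.comp_def, Multiset.map_coe, Multiset.sum_coe,
    List.map_cons, List.map_nil, List.sum_cons, List.sum_nil] at h'
  rw [Finset.sum, h']
  ring

section Sums

variable {V : Type} [Fintype V]

theorem sum_fun_fin_three (F : V → V → V → ℤ) :
    ∑ t : Fin 3 → V, F (t 0) (t 1) (t 2) = ∑ u, ∑ v, ∑ w, F u v w := by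
  simp only [← Fintype.sum_prod_type']
  refine Fintype.sum_equiv
    ⟨fun t ↦ (t 0, t 1, t 2), fun q ↦ ![q.1, q.2.1, q.2.2], fun t ↦ ?_, fun _ ↦ rfl⟩ _ _
    fun _ ↦ rfl
  ext i; fin_cases i <;> rfl

theorem sum_fun_fin_four (F : V → V → V → V → ℤ) :
    ∑ t : Fin 4 → V, F (t 0) (t 1) (t 2) (t 3) = ∑ u, ∑ v, ∑ w, ∑ x, F u v w x := by
  simp only [← Fintype.sum_prod_type']
  refine Fintype.sum_equiv
    ⟨fun t ↦ (t 0, t 1, t 2, t 3), fun q ↦ ![q.1, q.2.1, q.2.2.1, q.2.2.2],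
      fun t ↦ ?_, fun _ ↦ rfl⟩ _ _ fun _ ↦ rfl
  ext i; fin_cases i <;> rfl

theorem sum_sum_comp_perm {k : ℕ} (F : (Fin k → V) → ℤ) :
    ∑ t : Fin k → V, ∑ σ : Equiv.Perm (Fin k), F (t ∘ σ) = k.factorial * ∑ t, F t := by
  rw [Finset.sum_comm]
  have h (σ : Equiv.Perm (Fin k)) : ∑ t : Fin k → V, F (t ∘ σ) = ∑ t, F t :=
    (Equiv.arrowCongr σ.symm (Equiv.refl V)).sum_comp F
  simp [h, Fintype.card_perm]

theorem sum_sum_mul (c : ℤ) (f : V → ℤ) :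
    ∑ w, ∑ x, c * (f w * f x) = c * (∑ w, f w) ^ 2 := by
  simp_rw [← Finset.mul_sum, sq, Finset.sum_mul_sum, Finset.mul_sum]

/-- Every `k`-element set has `k!` orderings. -/
theorem card_injective_image [DecidableEq V] (k : ℕ) (P : Finset V → Prop) :
    (Finset.univ.filter fun t : Fin k → V ↦
      Function.Injective t ∧ P (Finset.univ.image t)).card =
      k.factorial * ((Finset.univ.powersetCard k).filter P).card := by
  rw [Finset.card_eq_sum_card_fiberwise (f := fun t ↦ Finset.univ.image t)
    (t := (Finset.univ.powersetCard k).filter P), mul_comm, ← smul_eq_mul]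
  · refine Finset.sum_const_nat fun s hs ↦ ?_
    obtain ⟨hs, hP⟩ := Finset.mem_filter.1 hs
    have hcard : Fintype.card (Fin k) = Fintype.card s := by
      simpa using (Finset.mem_powersetCard.1 hs).2.symm
    have hfactorial : (Finset.univ : Finset (Fin k ≃ s)).card = k.factorial := by
      rw [Finset.card_univ, Fintype.card_equiv (Fintype.equivOfCardEq hcard), Fintype.card_fin]
    rw [← hfactorial]
    symm
    refine Finset.card_bij (fun e _ i ↦ (e i : V)) (fun e _ ↦ ?_) (fun e _ e' _ h ↦ ?_)
      fun t ht ↦ ?_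
    · have himage : Finset.univ.image (fun i ↦ (e i : V)) = s := by
        ext v
        simp only [Finset.mem_image, Finset.mem_univ, true_and]
        exact ⟨fun ⟨i, hi⟩ ↦ hi ▸ (e i).2, fun hv ↦ ⟨e.symm ⟨v, hv⟩, by simp⟩⟩
      simp only [Finset.mem_filter, Finset.mem_univ, true_and, himage, and_true]
      exact ⟨Subtype.val_injective.comp e.injective, hP⟩
    · ext i
      exact congrFun h i
    · simp only [Finset.mem_filter, Finset.mem_univ, true_and] at ht
      obtain ⟨⟨hinj, -⟩, himage⟩ := ht
      have hmem (i : Fin k) : t i ∈ s := himage ▸ Finset.mem_image_of_mem t (Finset.mem_univ i)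
      refine ⟨Equiv.ofBijective (fun i ↦ ⟨t i, hmem i⟩) ?_, Finset.mem_univ _, rfl⟩
      rw [Fintype.bijective_iff_injective_and_card]
      exact ⟨fun i j h ↦ hinj (congrArg Subtype.val h), hcard⟩
  · intro t ht
    simp only [Finset.coe_filter, Finset.mem_univ, true_and, Set.mem_ofPred_eq] at ht
    simp [Finset.card_image_of_injective _ ht.1, ht.2]

end Sums

variable {V : Type} [Fintype V] [DecidableEq V] (G : OrientedGraph V)

/-- The orientation of a pair of vertices. -/
noncomputable def orient (u v : V) : SignType :=
  if G.adj u v then 1 else if G.adj v u then -1 else 0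

theorem orient_swap (u v : V) : G.orient v u = -G.orient u v := by
  have := G.asymm u v
  unfold orient
  split_ifs <;> simp_all

theorem sum_squareKernel_nonneg :
    0 ≤ ∑ t : Fin 4 → V, squareKernel (G.orient (t 0) (t 1)) (G.orient (t 0) (t 2))
      (G.orient (t 1) (t 2)) (G.orient (t 0) (t 3)) (G.orient (t 1) (t 3)) := by
  rw [sum_fun_fin_four fun u v w x ↦ squareKernel (G.orient u v) (G.orient u w)
    (G.orient v w) (G.orient u x) (G.orient v x)]
  refine Finset.sum_nonneg fun u _ ↦ Finset.sum_nonneg fun v _ ↦ ?_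
  cases G.orient u v with
  | neg => simp [squareKernel]
  | zero =>
    simp only [squareKernel, Finset.sum_add_distrib,
      sum_sum_mul _ fun w ↦ nonadjFlag₁ (G.orient u w) (G.orient v w),
      sum_sum_mul _ fun w ↦ nonadjFlag₂ (G.orient u w) (G.orient v w),
      sum_sum_mul _ fun w ↦ nonadjFlag₃ (G.orient u w) (G.orient v w)]
    positivity
  | pos =>
    simp only [squareKernel, Finset.sum_add_distrib,
      sum_sum_mul _ fun w ↦ arcFlag₁ (G.orient u w) (G.orient v w),
      sum_sum_mul _ fun w ↦ arcFlag₂ (G.orient u w) (G.orient v w),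
      sum_sum_mul _ fun w ↦ arcFlag₃ (G.orient u w) (G.orient v w),
      sum_sum_mul _ fun w ↦ arcFlag₄ (G.orient u w) (G.orient v w),
      sum_sum_mul _ fun w ↦ arcFlag₅ (G.orient u w) (G.orient v w)]
    positivity

theorem sum_quadWeight_nonneg :
    0 ≤ ∑ t : Fin 4 → V, quadWeight (G.orient (t 0) (t 1)) (G.orient (t 0) (t 2))
      (G.orient (t 0) (t 3)) (G.orient (t 1) (t 2)) (G.orient (t 1) (t 3))
      (G.orient (t 2) (t 3)) := by
  have h := sum_sum_comp_perm fun t : Fin 4 → V ↦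
    quadWeight (G.orient (t 0) (t 1)) (G.orient (t 0) (t 2)) (G.orient (t 0) (t 3))
      (G.orient (t 1) (t 2)) (G.orient (t 1) (t 3)) (G.orient (t 2) (t 3))
  refine nonneg_of_mul_nonneg_right (h ▸ Finset.sum_nonneg fun t _ ↦ ?_)
    (by positivity : (0 : ℤ) < (4).factorial)
  have h' := sum_perm_fin_four fun i j k l ↦
    quadWeight (G.orient (t i) (t j)) (G.orient (t i) (t k)) (G.orient (t i) (t l))
      (G.orient (t j) (t k)) (G.orient (t j) (t l)) (G.orient (t k) (t l))
  refine h'.symm ▸ ?_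
  rw [G.orient_swap (t 0) (t 1), G.orient_swap (t 0) (t 2), G.orient_swap (t 0) (t 3),
    G.orient_swap (t 1) (t 2), G.orient_swap (t 1) (t 3), G.orient_swap (t 2) (t 3)]
  exact quadWeight_symm_nonneg _ _ _ _ _ _

theorem isAdj_orient {u v : V} (h : G.adj u v ∨ G.adj v u) : isAdj (G.orient u v) = 1 := by
  unfold orient
  split_ifs <;> simp_all [isAdj]

theorem factorial_mul_K4Count_le :
    (24 * G.K4Count : ℤ) ≤ ∑ t : Fin 4 → V, isAdj (G.orient (t 0) (t 1)) *
      isAdj (G.orient (t 0) (t 2)) * isAdj (G.orient (t 0) (t 3)) *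
      isAdj (G.orient (t 1) (t 2)) * isAdj (G.orient (t 1) (t 3)) *
      isAdj (G.orient (t 2) (t 3)) := by
  have h := card_injective_image (V := V) 4
    fun s ↦ ∀ x ∈ s, ∀ y ∈ s, x ≠ y → (G.adj x y ∨ G.adj y x)
  have h' : (24 * G.K4Count : ℤ) = ∑ t : Fin 4 → V, if Function.Injective t ∧
      ∀ x ∈ Finset.univ.image t, ∀ y ∈ Finset.univ.image t, x ≠ y →
        (G.adj x y ∨ G.adj y x) then 1 else 0 := by
    rw [Finset.sum_boole, K4Count]
    exact_mod_cast h.symm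
  rw [h']
  refine Finset.sum_le_sum fun t _ ↦ ?_
  split_ifs with ht
  · have hadj (i j : Fin 4) (hij : i ≠ j) : isAdj (G.orient (t i) (t j)) = 1 :=
      G.isAdj_orient (ht.2 _ (by simp) _ (by simp) (ht.1.ne hij))
    simp [hadj]
  · have hnonneg (a : SignType) : 0 ≤ isAdj a := by cases a <;> simp [isAdj]
    have := fun u v ↦ hnonneg (G.orient u v)
    exact mul_nonneg (mul_nonneg (mul_nonneg (mul_nonneg (mul_nonneg (this _ _) (this _ _))
      (this _ _)) (this _ _)) (this _ _)) (this _ _)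

theorem indepOrTrans_le_one (a b c : SignType) : indepOrTrans a b c ≤ 1 := by
  revert a b c; decide

theorem indepOrTrans_nonneg (a b c : SignType) : 0 ≤ indepOrTrans a b c := by
  revert a b c; decide

theorem isTransTriangle_or_isIndep {x y z : V}
    (h : indepOrTrans (G.orient x y) (G.orient x z) (G.orient y z) ≠ 0) :
    G.isTransTriangle {x, y, z} ∨ G.isIndep {x, y, z} := by
  have key (u v : V) : G.orient u v = .zero ∧ ¬ G.adj u v ∧ ¬ G.adj v u ∨
      G.orient u v = .pos ∧ G.adj u v ∨ G.orient u v = .neg ∧ G.adj v u := by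
    unfold orient
    split_ifs <;> simp_all
  have hirr (u : V) : ¬ G.adj u u := fun hu ↦ G.asymm u u hu hu
  have perm₁ : ({x, y, z} : Finset V) = {x, z, y} := by grind
  have perm₂ : ({x, y, z} : Finset V) = {y, x, z} := by grind
  have perm₃ : ({x, y, z} : Finset V) = {y, z, x} := by grind
  have perm₄ : ({x, y, z} : Finset V) = {z, x, y} := by grind
  have perm₅ : ({x, y, z} : Finset V) = {z, y, x} := by grind
  rcases key x y with ⟨h₁, h₁'⟩ | ⟨h₁, h₁'⟩ | ⟨h₁, h₁'⟩ <;>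
  rcases key x z with ⟨h₂, h₂'⟩ | ⟨h₂, h₂'⟩ | ⟨h₂, h₂'⟩ <;>
  rcases key y z with ⟨h₃, h₃'⟩ | ⟨h₃, h₃'⟩ | ⟨h₃, h₃'⟩ <;>
  rw [h₁, h₂, h₃] at h <;>
  first
  | exact absurd rfl h
  | exact .inl ⟨x, y, z, rfl, ‹_›, ‹_›, ‹_›⟩
  | exact .inl ⟨x, z, y, perm₁, ‹_›, ‹_›, ‹_›⟩
  | exact .inl ⟨y, x, z, perm₂, ‹_›, ‹_›, ‹_›⟩
  | exact .inl ⟨y, z, x, perm₃, ‹_›, ‹_›, ‹_›⟩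
  | exact .inl ⟨z, x, y, perm₄, ‹_›, ‹_›, ‹_›⟩
  | exact .inl ⟨z, y, x, perm₅, ‹_›, ‹_›, ‹_›⟩
  | exact .inr (by simp [isIndep, *])

theorem sum_indepOrTrans_le :
    ∑ t : Fin 3 → V, indepOrTrans (G.orient (t 0) (t 1)) (G.orient (t 0) (t 2))
      (G.orient (t 1) (t 2)) ≤ 6 * G.T3 + 6 * G.I3 + 3 * Fintype.card V ^ 2 := by
  have hcount (P : Finset V → Prop) : (∑ t : Fin 3 → V, if Function.Injective t ∧
      P (Finset.univ.image t) then 1 else 0 : ℤ) =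
      6 * ((Finset.univ.powersetCard 3).filter P).card := by
    rw [Finset.sum_boole]
    exact_mod_cast card_injective_image 3 P
  have h₀₁ : (∑ t : Fin 3 → V, if t 0 = t 1 then 1 else 0 : ℤ) = Fintype.card V ^ 2 := by
    rw [sum_fun_fin_three fun u v _ ↦ if u = v then 1 else 0]
    simp [sq]
  have h₀₂ : (∑ t : Fin 3 → V, if t 0 = t 2 then 1 else 0 : ℤ) = Fintype.card V ^ 2 := by
    rw [sum_fun_fin_three fun u _ w ↦ if u = w then 1 else 0]
    simp [sq]
  have h₁₂ : (∑ t : Fin 3 → V, if t 1 = t 2 then 1 else 0 : ℤ) = Fintype.card V ^ 2 := by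
    rw [sum_fun_fin_three fun _ v w ↦ if v = w then 1 else 0]
    simp [sq]
  calc _ ≤ ∑ t : Fin 3 → V,
        ((if Function.Injective t ∧ G.isTransTriangle (Finset.univ.image t) then 1 else 0) +
        (if Function.Injective t ∧ G.isIndep (Finset.univ.image t) then 1 else 0) +
        (if t 0 = t 1 then 1 else 0) + (if t 0 = t 2 then 1 else 0) +
        (if t 1 = t 2 then 1 else 0) : ℤ) := Finset.sum_le_sum fun t _ ↦ ?_
    _ = _ := by
      simp only [Finset.sum_add_distrib, hcount, h₀₁, h₀₂, h₁₂, T3, I3]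
      ring
  have himage : Finset.univ.image t = {t 0, t 1, t 2} := by
    ext v; simp [Fin.exists_fin_succ, eq_comm]
  have hle := indepOrTrans_le_one (G.orient (t 0) (t 1)) (G.orient (t 0) (t 2))
    (G.orient (t 1) (t 2))
  by_cases hinj : Function.Injective t
  · by_cases h : indepOrTrans (G.orient (t 0) (t 1)) (G.orient (t 0) (t 2))
      (G.orient (t 1) (t 2)) = 0
    · rw [h]
      positivity
    · rcases G.isTransTriangle_or_isIndep h with h | h <;>
      · rw [himage]
        simp only [hinj, h, and_self, if_true]
        split_ifs <;> omega
  · have : t 0 = t 1 ∨ t 0 = t 2 ∨ t 1 = t 2 := by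
      by_contra! hne
      refine hinj fun i j hij ↦ ?_
      fin_cases i <;> fin_cases j <;> simp_all
    split_ifs <;> first | omega | simp_all

theorem K4Count_le :
    (24 * G.K4Count : ℤ) + 4 * Fintype.card V ^ 4 ≤
      36 * Fintype.card V * (6 * G.T3 + 6 * G.I3 + 3 * Fintype.card V ^ 2) := by
  have h := G.sum_quadWeight_nonneg
  have h₁ := G.sum_squareKernel_nonneg
  have h₂ := G.factorial_mul_K4Count_le
  have h₃ := G.sum_indepOrTrans_le
  have h₄ : ∑ t : Fin 4 → V, indepOrTrans (G.orient (t 0) (t 1)) (G.orient (t 0) (t 2))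
      (G.orient (t 1) (t 2)) = Fintype.card V * ∑ t : Fin 3 → V, indepOrTrans
        (G.orient (t 0) (t 1)) (G.orient (t 0) (t 2)) (G.orient (t 1) (t 2)) := by
    rw [sum_fun_fin_three fun u v w ↦ indepOrTrans (G.orient u v) (G.orient u w) (G.orient v w),
      sum_fun_fin_four fun u v w _ ↦
        indepOrTrans (G.orient u v) (G.orient u w) (G.orient v w)]
    simp [Finset.mul_sum]
  simp only [quadWeight, Finset.sum_sub_distrib, ← Finset.mul_sum, h₄] at h
  simp only [Finset.sum_const, Finset.card_univ, Fintype.card_fun, Fintype.card_fin,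
    nsmul_eq_mul] at h
  push_cast at h
  have h₅ := mul_le_mul_of_nonneg_left h₃ (Nat.cast_nonneg (α := ℤ) (Fintype.card V))
  linarith

end OrientedGraph

/-- There is a constant C > 0 such that for every δ > 0 there is n₁ such that
every oriented graph `G` on `n ≥ n₁` vertices with `t(G) + i(G) ≤ 1/9 + δ`
satisfies `p(K₄, G⁽⁰⁾) ≤ C·δ` where `G⁽⁰⁾` is the underlying undirected graph. -/
theorem stmt_12 :
    ∃ C : ℝ, 0 < C ∧ ∀ δ : ℝ, 0 < δ → ∃ n₁ : ℕ, 0 < n₁ ∧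
      ∀ n : ℕ, n₁ ≤ n → ∀ G : OrientedGraph (Fin n),
        G.tDens + G.iDens ≤ 1 / 9 + δ → G.K4Dens ≤ C * δ := by
  refine ⟨576, by norm_num, fun δ hδ ↦ ⟨max 6 ⌈3 / δ⌉₊, by positivity, fun n hn G hG ↦ ?_⟩⟩
  have hn₆ : 6 ≤ n := (le_max_left _ _).trans hn
  have hn₆' : (6 : ℝ) ≤ n := by exact_mod_cast hn₆
  have hnδ : 3 ≤ δ * n := by
    have : 3 / δ ≤ n := (Nat.le_ceil _).trans (by exact_mod_cast (le_max_right _ _).trans hn)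
    rwa [div_le_iff₀' hδ] at this
  have hK : (24 * G.K4Count : ℝ) + 4 * n ^ 4 ≤ 36 * n * (6 * G.T3 + 6 * G.I3 + 3 * n ^ 2) := by
    have := G.K4Count_le
    rw [Fintype.card_fin] at this
    exact_mod_cast this
  obtain ⟨m, rfl⟩ := Nat.exists_eq_add_of_le hn₆
  have hc₃ : (6 * (6 + m).choose 3 : ℝ) = (6 + m : ℕ) * ((6 + m : ℕ) - 1) * ((6 + m : ℕ) - 2) := by
    have h : 6 * (6 + m).choose 3 = (m + 4) * ((m + 5) * (m + 6)) := by
      rw [add_comm 6 m]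
      simpa [Nat.descFactorial, Nat.factorial] using
        (Nat.descFactorial_eq_factorial_mul_choose (m + 6) 3).symm
    have h' : (6 * (6 + m).choose 3 : ℝ) = (m + 4) * ((m + 5) * (m + 6)) := by exact_mod_cast h
    rw [h']; push_cast; ring
  have hc₄ : (24 * (6 + m).choose 4 : ℝ) =
      (6 + m : ℕ) * ((6 + m : ℕ) - 1) * ((6 + m : ℕ) - 2) * ((6 + m : ℕ) - 3) := by
    have h : 24 * (6 + m).choose 4 = (m + 3) * ((m + 4) * ((m + 5) * (m + 6))) := by
      rw [add_comm 6 m]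
      simpa [Nat.descFactorial, Nat.factorial] using
        (Nat.descFactorial_eq_factorial_mul_choose (m + 6) 4).symm
    have h' : (24 * (6 + m).choose 4 : ℝ) = (m + 3) * ((m + 4) * ((m + 5) * (m + 6))) := by
      exact_mod_cast h
    rw [h']; push_cast; ring
  generalize 6 + m = n at *
  have hpos₃ : (0 : ℝ) < n.choose 3 := by exact_mod_cast Nat.choose_pos (by omega)
  have hpos₄ : (0 : ℝ) < n.choose 4 := by exact_mod_cast Nat.choose_pos (by omega)
  rw [OrientedGraph.tDens, OrientedGraph.iDens, Fintype.card_fin, ← add_div,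
    div_le_iff₀ hpos₃] at hG
  rw [OrientedGraph.K4Dens, Fintype.card_fin, div_le_iff₀ hpos₄]
  have hle₃ : (6 * n.choose 3 : ℝ) ≤ n ^ 3 := by
    rw [hc₃]
    nlinarith [mul_nonneg (by linarith : (0 : ℝ) ≤ n) (by linarith : (0 : ℝ) ≤ 3 * n - 2)]
  have hle₄ : (n : ℝ) ^ 4 ≤ 8 * (24 * n.choose 4) := by
    rw [hc₄]
    calc (n : ℝ) ^ 4 = 8 * (n * (n / 2) * (n / 2) * (n / 2)) := by ring
      _ ≤ _ := by gcongr <;> nlinarith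
  have hTI : (6 * G.T3 + 6 * G.I3 : ℝ) ≤ (1 / 9 + δ) * n ^ 3 := by
    have := mul_le_mul_of_nonneg_left hle₃ (by positivity : 0 ≤ 1 / 9 + δ)
    linarith
  have h₁ : 36 * (n : ℝ) * (6 * G.T3 + 6 * G.I3 + 3 * n ^ 2) ≤
      36 * n * ((1 / 9 + δ) * n ^ 3 + 3 * n ^ 2) := by gcongr
  have h₂ : 3 * (n : ℝ) ^ 3 ≤ δ * n ^ 4 := by
    calc 3 * (n : ℝ) ^ 3 ≤ δ * n * n ^ 3 := by gcongr
      _ = δ * n ^ 4 := by ring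
  have h₃ := mul_le_mul_of_nonneg_left hle₄ hδ.le
  nlinarith
end

section
/- For every 0 < ε < 1/13 there is a positive integer n₂ such that the following holds: if G is a K₄-free finite simple (undirected) graph on n ≥ n₂ vertices with Δ̄(G) ≤ 1/9 + ε⁶, and B is the set of vertices of G whose degree is less than (2/3 − 5ε²)·n, then (1) |B| ≤ 5ε²·n, and (2) the induced subgraph of G on V(G) \ B is 3-partite, i.e., its vertex set can be partitioned into three independent sets. -/
open scoped Classical

open GoodmanStmt

namespace GoodmanStmt

/-- The degree of a vertex in a simple graph (classically counted). -/
noncomputable def degC {V : Type} [Fintype V] [DecidableEq V]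
    (G : SimpleGraph V) (v : V) : ℕ :=
  (Finset.univ.filter (fun w => G.Adj v w)).card

end GoodmanStmt

namespace GoodmanStmt

/-- The value of a flag: the first three arguments are the adjacencies `xy`, `xz`, `yz` of a rooted
triple, the last three the adjacencies of a further vertex to `x`, `y`, `z`. -/
abbrev Flag := Bool → Bool → Bool → Bool → Bool → Bool → ℤ

/-- A flag supported on empty triples, orthogonal to the balanced complete tripartite graph. -/
def emptyFlag : Flag
  | false, false, false, false, false, false => 2
  | false, false, false, true, true, true => -1
  | _, _, _, _, _, _ => 0

/-- Extend a function of (endpoint, centre, endpoint) adjacencies to a flag on induced paths. -/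
def onPath (f : Bool → Bool → Bool → ℤ) : Flag
  | true, true, false, x, y, z => f y x z
  | true, false, true, x, y, z => f x y z
  | false, true, true, x, y, z => f x z y
  | _, _, _, _, _, _ => 0

/-- Extend a function of (isolated vertex, endpoint, endpoint) adjacencies to a flag on triples
spanning exactly one edge. -/
def onEdge (f : Bool → Bool → Bool → ℤ) : Flag
  | true, false, false, x, y, z => f z x y
  | false, true, false, x, y, z => f y x z
  | false, false, true, x, y, z => f x y z
  | _, _, _, _, _, _ => 0

/-- Path flags invariant under exchanging the endpoints. -/
def symPath (c₀ c₁ c₂ c₃ c₄ : ℤ) : Flag := onPath fun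
  | false, false, false => c₀
  | true, false, false | false, false, true => c₁
  | true, true, false | false, true, true => c₂
  | true, false, true => c₃
  | true, true, true => c₄
  | false, true, false => -(c₃ + c₄)

/-- Path flags changing sign when the endpoints are exchanged. -/
def altPath (c₀ c₁ : ℤ) : Flag := onPath fun
  | true, false, false => c₀
  | false, false, true => -c₀
  | true, true, false => c₁
  | false, true, true => -c₁
  | _, _, _ => 0

/-- Single-edge flags invariant under exchanging the endpoints of the edge. -/
def symEdge (c₀ c₁ c₂ d₀ d₁ d₂ : ℤ) : Flag := onEdge fun
  | false, false, false => c₀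
  | false, true, false | false, false, true => c₁
  | false, true, true => c₂
  | true, false, false => d₀
  | true, true, false | true, false, true => d₁
  | true, true, true => d₂

/-- The weighted squares of the certificate. -/
def weightedFlags : List (ℤ × Flag) :=
  [(3192, emptyFlag),
   (24, symPath 0 1 (-1) 2 1), (192, symPath 1 1 0 0 2), (1492, symPath 0 1 (-1) 2 0),
   (2280, symPath 1 (-1) 1 (-2) 2), (1076, symPath 2 (-1) 1 (-2) 0),
   (3120, altPath 1 (-1)), (742, altPath 1 2), (10808, altPath 1 0),
   (1281, symEdge (-1) (-2) 1 0 0 2), (616, symEdge 0 (-2) 2 (-1) 0 2),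
   (4760, symEdge (-1) 0 (-2) 1 1 (-1)), (2828, symEdge 2 1 (-1) (-1) 0 (-1)),
   (1624, symEdge 2 1 (-2) 1 1 (-2))]

/-- The centred adjacency indicator, scaled by three. -/
def centred (b : Bool) : ℤ := bif b then 1 else -2

/-- The part of the certificate depending on a triple only. -/
def tripleTerm (p q r : Bool) : ℤ :=
  15120 * (bif p || q || r then 0 else 1) - 1680
    - 56 * (centred p * centred q + centred p * centred r + centred q * centred r)

/-- The quadratic form of the certificate. -/
def flagForm (l : List (ℤ × Flag)) (p q r x y z x' y' z' : Bool) : ℤ :=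
  (l.map fun c => c.1 * (c.2 p q r x y z * c.2 p q r x' y' z')).sum

/-- The contribution of a rooted triple together with two further vertices. -/
def localTerm (p q r x y z x' y' z' : Bool) : ℤ :=
  tripleTerm p q r - flagForm weightedFlags p q r x y z x' y' z'

/-- The certificate summed over the ten splittings of five vertices `0, …, 4` into a triple and
a pair. -/
def fiveVertexSum (b01 b02 b03 b04 b12 b13 b14 b23 b24 b34 : Bool) : ℤ :=
  localTerm b01 b02 b12 b03 b13 b23 b04 b14 b24 +
  localTerm b01 b03 b13 b02 b12 b23 b04 b14 b34 +
  localTerm b01 b04 b14 b02 b12 b24 b03 b13 b34 +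
  localTerm b02 b03 b23 b01 b12 b13 b04 b24 b34 +
  localTerm b02 b04 b24 b01 b12 b14 b03 b23 b34 +
  localTerm b03 b04 b34 b01 b13 b14 b02 b23 b24 +
  localTerm b12 b13 b23 b01 b02 b03 b14 b24 b34 +
  localTerm b12 b14 b24 b01 b02 b04 b13 b23 b34 +
  localTerm b13 b14 b34 b01 b03 b04 b12 b23 b24 +
  localTerm b23 b24 b34 b02 b03 b04 b12 b13 b14

theorem fiveVertexSum_nonneg : ∀ b01 b02 b03 b12 b13 b23 : Bool,
    (b01 && b02 && b03 && b12 && b13 && b23) = false →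
    ∀ b04 b14 b24 b34 : Bool,
    (b01 && b02 && b04 && b12 && b14 && b24) = false →
    (b01 && b03 && b04 && b13 && b14 && b34) = false →
    (b02 && b03 && b04 && b23 && b24 && b34) = false →
    (b12 && b13 && b14 && b23 && b24 && b34) = false →
    0 ≤ fiveVertexSum b01 b02 b03 b04 b12 b13 b14 b23 b24 b34 := by
  decide +kernel

section Sums

variable {V : Type} [Fintype V]

/-- The sum of a function over all 5-tuples. -/
def sumFive (F : V → V → V → V → V → ℤ) : ℤ := ∑ a, ∑ b, ∑ c, ∑ d, ∑ e, F a b c d e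

theorem sumFive_swap₁ (F : V → V → V → V → V → ℤ) :
    sumFive F = sumFive fun a b c d e => F b a c d e :=
  Finset.sum_comm

theorem sumFive_swap₂ (F : V → V → V → V → V → ℤ) :
    sumFive F = sumFive fun a b c d e => F a c b d e :=
  Finset.sum_congr rfl fun _ _ => Finset.sum_comm

theorem sumFive_swap₃ (F : V → V → V → V → V → ℤ) :
    sumFive F = sumFive fun a b c d e => F a b d c e :=
  Finset.sum_congr rfl fun _ _ => Finset.sum_congr rfl fun _ _ => Finset.sum_comm

theorem sumFive_swap₄ (F : V → V → V → V → V → ℤ) :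
    sumFive F = sumFive fun a b c d e => F a b c e d :=
  Finset.sum_congr rfl fun _ _ => Finset.sum_congr rfl fun _ _ =>
    Finset.sum_congr rfl fun _ _ => Finset.sum_comm

/-- A sum over 5-tuples is nonnegative if its symmetrisation over the ten splittings into a triple
and a pair is nonnegative. -/
theorem sumFive_nonneg_of_splittings (F : V → V → V → V → V → ℤ)
    (h : ∀ a b c d e, 0 ≤ F a b c d e + F a b d c e + F a b e c d + F a c d b e + F a c e b d +
      F a d e b c + F b c d a e + F b c e a d + F b d e a c + F c d e a b) :
    0 ≤ sumFive F := by
  have h₁ := sumFive_swap₃ F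
  have h₂ := h₁.trans (sumFive_swap₄ _)
  have h₃ := h₁.trans (sumFive_swap₂ _)
  have h₄ := h₂.trans (sumFive_swap₂ _)
  have h₅ := h₄.trans (sumFive_swap₃ _)
  have h₆ := h₃.trans (sumFive_swap₁ _)
  have h₇ := h₄.trans (sumFive_swap₁ _)
  have h₈ := h₅.trans (sumFive_swap₁ _)
  have h₉ := h₈.trans (sumFive_swap₂ _)
  have hsum : 0 ≤ sumFive fun a b c d e => F a b c d e + F a b d c e + F a b e c d +
      F a c d b e + F a c e b d + F a d e b c + F b c d a e + F b c e a d + F b d e a c +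
      F c d e a b :=
    Finset.sum_nonneg fun a _ => Finset.sum_nonneg fun b _ => Finset.sum_nonneg fun c _ =>
      Finset.sum_nonneg fun d _ => Finset.sum_nonneg fun e _ => h a b c d e
  simp only [sumFive, Finset.sum_add_distrib] at *
  linarith

theorem sum_flagForm_nonneg (l : List (ℤ × Flag)) (hl : ∀ c ∈ l, 0 ≤ c.1) (p q r : Bool)
    (x y z : V → Bool) :
    0 ≤ ∑ v, ∑ w, flagForm l p q r (x v) (y v) (z v) (x w) (y w) (z w) := by
  induction l with
  | nil => simp [flagForm]
  | cons c l ih =>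
    have h := ih fun c' hc' => hl c' (List.mem_cons_of_mem _ hc')
    have hc := hl c List.mem_cons_self
    have hsq : ∑ v, ∑ w, c.1 * (c.2 p q r (x v) (y v) (z v) * c.2 p q r (x w) (y w) (z w)) =
        c.1 * (∑ v, c.2 p q r (x v) (y v) (z v)) ^ 2 := by
      rw [sq, Finset.sum_mul_sum, Finset.mul_sum]
      simp only [Finset.mul_sum]
    simp only [flagForm, List.map_cons, List.sum_cons, Finset.sum_add_distrib] at h ⊢
    rw [hsq]
    positivity

/-- For a symmetric 0/1-matrix without `K₄`, the certificate bounds the triple terms. -/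
theorem sum_tripleTerm_nonneg (A : V → V → Bool) (hA : ∀ u v, A u v = A v u)
    (hK : ∀ a b c d, (A a b && A a c && A a d && A b c && A b d && A c d) = false) :
    0 ≤ (Fintype.card V : ℤ) ^ 2 * ∑ a, ∑ b, ∑ c, tripleTerm (A a b) (A a c) (A b c) := by
  have hF : 0 ≤ sumFive fun a b c d e => localTerm (A a b) (A a c) (A b c)
      (A a d) (A b d) (A c d) (A a e) (A b e) (A c e) := by
    refine sumFive_nonneg_of_splittings _ fun a b c d e => ?_
    have := fiveVertexSum_nonneg _ _ _ _ _ _ (hK a b c d) _ _ _ _ (hK a b c e) (hK a b d e)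
      (hK a c d e) (hK b c d e)
    simpa only [fiveVertexSum, hA b a, hA c a, hA d a, hA c b, hA d b, hA d c, hA e a, hA e b,
      hA e c, hA e d] using this
  have hQ : 0 ≤ ∑ a, ∑ b, ∑ c, ∑ d, ∑ e, flagForm weightedFlags (A a b) (A a c) (A b c)
      (A a d) (A b d) (A c d) (A a e) (A b e) (A c e) :=
    Finset.sum_nonneg fun a _ => Finset.sum_nonneg fun b _ => Finset.sum_nonneg fun c _ =>
      sum_flagForm_nonneg _ (by simp [weightedFlags]) _ _ _ (A a) (A b) (A c)
  simp only [sumFive, localTerm, Finset.sum_sub_distrib, Finset.sum_const, Finset.card_univ,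
    nsmul_eq_mul, ← Finset.mul_sum] at hF
  linarith

/-- In a symmetric 0/1-matrix without `K₄`, the number of independent ordered triples, repetitions
allowed, is at least a ninth of all triples, with a gain governed by the variation of the
degrees. -/
theorem le_sum_indep [Nonempty V] (A : V → V → Bool) (hA : ∀ u v, A u v = A v u)
    (hK : ∀ a b c d, (A a b && A a c && A a d && A b c && A b d && A c d) = false) :
    10 * (Fintype.card V : ℤ) ^ 3 + ∑ a, (∑ b, centred (A a b)) ^ 2 ≤
      90 * ∑ a, ∑ b, ∑ c, (bif A a b || A a c || A b c then 0 else 1) := by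
  have h := nonneg_of_mul_nonneg_right (sum_tripleTerm_nonneg A hA hK) (by positivity)
  have h₁ : ∑ a, ∑ b, ∑ c, centred (A a b) * centred (A a c) = ∑ a, (∑ b, centred (A a b)) ^ 2 := by
    simp only [sq, Finset.sum_mul_sum]
  have h₂ : ∑ a, ∑ b, ∑ c, centred (A a b) * centred (A b c) = ∑ a, (∑ b, centred (A a b)) ^ 2 := by
    rw [← h₁, Finset.sum_comm]
    exact Finset.sum_congr rfl fun a _ => Finset.sum_congr rfl fun b _ => by rw [hA]
  have h₃ : ∑ a, ∑ b, ∑ c, centred (A a c) * centred (A b c) = ∑ a, (∑ b, centred (A a b)) ^ 2 := by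
    rw [← h₂]
    refine Finset.sum_congr rfl fun a _ => Finset.sum_comm.trans ?_
    exact Finset.sum_congr rfl fun b _ => Finset.sum_congr rfl fun c _ => by rw [hA b c]
  simp only [← Finset.mul_sum] at h₁ h₂
  simp only [tripleTerm, Finset.sum_sub_distrib, Finset.sum_add_distrib, ← Finset.mul_sum,
    h₁, h₂, h₃, Finset.sum_const, Finset.card_univ, nsmul_eq_mul] at h
  linarith

end Sums

theorem no_four_clique {V : Type} {G : SimpleGraph V} (hG : G.CliqueFree 4) (a b c d : V) :
    (decide (G.Adj a b) && decide (G.Adj a c) && decide (G.Adj a d) && decide (G.Adj b c) &&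
      decide (G.Adj b d) && decide (G.Adj c d)) = false := by
  by_contra h
  simp only [Bool.not_eq_false, Bool.and_eq_true, decide_eq_true_eq] at h
  obtain ⟨⟨⟨⟨⟨hab, hac⟩, had⟩, hbc⟩, hbd⟩, hcd⟩ := h
  exact hG _ ((SimpleGraph.is3Clique_triple_iff.2 ⟨hbc, hbd, hcd⟩).insert (a := a) (by simp [*]))

section Graph

variable {V : Type} [Fintype V] [DecidableEq V]

theorem card_ordered_indep_le (G : SimpleGraph V) :
    (Finset.univ.filter fun t : V × V × V =>
      (¬ G.Adj t.1 t.2.1 ∧ ¬ G.Adj t.1 t.2.2 ∧ ¬ G.Adj t.2.1 t.2.2) ∧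
        t.1 ≠ t.2.1 ∧ t.1 ≠ t.2.2 ∧ t.2.1 ≠ t.2.2).card ≤ 6 * indepCount G := by
  refine Finset.card_le_mul_card_image_of_maps_to
    (f := fun t : V × V × V => ({t.1, t.2.1, t.2.2} : Finset V)) ?_ 6 ?_
  · rintro ⟨a, b, c⟩ h
    simp only [Finset.mem_filter, Finset.mem_univ, true_and] at h
    obtain ⟨⟨h₁, h₂, h₃⟩, hab, hac, hbc⟩ := h
    rw [Finset.mem_filter, Finset.mem_powersetCard]
    refine ⟨⟨Finset.subset_univ _, Finset.card_eq_three.2 ⟨a, b, c, hab, hac, hbc, rfl⟩⟩, ?_⟩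
    intro x hx y hy
    simp only [Finset.mem_insert, Finset.mem_singleton] at hx hy
    rcases hx with rfl | rfl | rfl <;> rcases hy with rfl | rfl | rfl <;>
      simp_all [G.adj_comm]
  · intro s hs
    rw [Finset.mem_filter, Finset.mem_powersetCard, Finset.card_eq_three] at hs
    obtain ⟨⟨-, x, y, z, hxy, hxz, hyz, rfl⟩, -⟩ := hs
    refine (Finset.card_le_card (t := {(x, y, z), (x, z, y), (y, x, z), (y, z, x), (z, x, y),
      (z, y, x)}) ?_).trans Finset.card_le_six
    rintro ⟨a, b, c⟩ h
    simp only [Finset.mem_filter, Finset.mem_univ, true_and] at h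
    obtain ⟨⟨-, hab, hac, hbc⟩, h⟩ := h
    have ha : a ∈ ({x, y, z} : Finset V) := h ▸ by simp
    have hb : b ∈ ({x, y, z} : Finset V) := h ▸ by simp
    have hc : c ∈ ({x, y, z} : Finset V) := h ▸ by simp
    simp only [Finset.mem_insert, Finset.mem_singleton] at ha hb hc
    clear h
    rcases ha with rfl | rfl | rfl <;> rcases hb with rfl | rfl | rfl <;>
      rcases hc with rfl | rfl | rfl <;> simp_all

theorem sum_indep_le (G : SimpleGraph V) :
    ∑ a, ∑ b, ∑ c, (bif decide (G.Adj a b) || decide (G.Adj a c) || decide (G.Adj b c)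
      then (0 : ℤ) else 1) ≤ 6 * indepCount G + 3 * (Fintype.card V : ℤ) ^ 2 := by
  have hdeg : ∑ a : V, ∑ b : V, ∑ c : V, ((if a = b then (1 : ℤ) else 0) +
      (if a = c then 1 else 0) + (if b = c then 1 else 0)) = 3 * (Fintype.card V : ℤ) ^ 2 := by
    simp [Finset.sum_add_distrib]
    ring
  have hcard : ∑ a, ∑ b, ∑ c, (if (¬ G.Adj a b ∧ ¬ G.Adj a c ∧ ¬ G.Adj b c) ∧
      a ≠ b ∧ a ≠ c ∧ b ≠ c then (1 : ℤ) else 0) ≤ 6 * indepCount G := by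
    have := card_ordered_indep_le G
    rw [Finset.card_filter, Fintype.sum_prod_type] at this
    simp only [Fintype.sum_prod_type] at this
    exact_mod_cast this
  refine le_trans ?_ (add_le_add hcard hdeg.le)
  simp only [← Finset.sum_add_distrib]
  refine Finset.sum_le_sum fun a _ => Finset.sum_le_sum fun b _ => Finset.sum_le_sum fun c _ => ?_
  by_cases h₁ : G.Adj a b <;> by_cases h₂ : G.Adj a c <;> by_cases h₃ : G.Adj b c <;>
    by_cases h₄ : a = b <;> by_cases h₅ : a = c <;> by_cases h₆ : b = c <;> simp_all

theorem sum_centred_adj (G : SimpleGraph V) (a : V) :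
    ∑ b, centred (decide (G.Adj a b)) = 3 * degC G a - 2 * Fintype.card V := by
  have h : ∀ b, centred (decide (G.Adj a b)) = 3 * (if G.Adj a b then 1 else 0) - 2 := fun b => by
    by_cases h : G.Adj a b <;> simp [centred, h]
  simp only [h, Finset.sum_sub_distrib, ← Finset.mul_sum, degC, Finset.card_filter]
  simp [mul_comm]

/-- A `K₄`-free graph with few independent triples has small degree variation around `2n/3`. -/
theorem sum_sq_degC_sub_le [Nonempty V] {G : SimpleGraph V} (hG : G.CliqueFree 4) :
    10 * (Fintype.card V : ℤ) ^ 3 + ∑ a, (3 * (degC G a : ℤ) - 2 * Fintype.card V) ^ 2 ≤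
      540 * indepCount G + 270 * (Fintype.card V : ℤ) ^ 2 := by
  have h := le_sum_indep (fun a b => decide (G.Adj a b)) (fun a b => by simp [G.adj_comm])
    (no_four_clique hG)
  simp only [sum_centred_adj] at h
  linarith [sum_indep_le G]

/-- Few vertices of a `K₄`-free graph with nearly extremal `indepDens` have low degree. -/
theorem card_low_degree_le {n : ℕ} {G : SimpleGraph (Fin n)} (hG : G.CliqueFree 4) {ε : ℝ}
    (hε : 0 < ε) (hn : 3 ≤ n) (hnε : 2 ≤ ε ^ 6 * n) (hI : indepDens G ≤ 1 / 9 + ε ^ 6)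
    (B : Finset (Fin n)) (hB : ∀ v ∈ B, (degC G v : ℝ) < (2 / 3 - 5 * ε ^ 2) * n) :
    (B.card : ℝ) ≤ 5 * ε ^ 2 * n := by
  have : Nonempty (Fin n) := ⟨⟨0, by omega⟩⟩
  have hn' : (0 : ℝ) < n := by exact_mod_cast (by omega : 0 < n)
  have hcount : 6 * (indepCount G : ℝ) ≤ (1 / 9 + ε ^ 6) * n ^ 3 := by
    have hchoose : (0 : ℝ) < n.choose 3 := by exact_mod_cast Nat.choose_pos hn
    rw [indepDens, Fintype.card_fin, div_le_iff₀ hchoose] at hI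
    have hle : (n.choose 3 : ℝ) ≤ n ^ 3 / 6 := by
      simpa [Nat.factorial] using Nat.choose_le_pow_div (α := ℝ) 3 n
    have := mul_le_mul_of_nonneg_left hle (show 0 ≤ 1 / 9 + ε ^ 6 by positivity)
    linarith
  have hsum : (10 * (n : ℝ) ^ 3 + ∑ a, (3 * (degC G a : ℝ) - 2 * n) ^ 2) ≤
      540 * indepCount G + 270 * (n : ℝ) ^ 2 := by
    have := sum_sq_degC_sub_le hG
    rw [Fintype.card_fin] at this
    exact_mod_cast this
  have hlow : (B.card : ℝ) * (15 * ε ^ 2 * n) ^ 2 ≤ ∑ a, (3 * (degC G a : ℝ) - 2 * n) ^ 2 := by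
    rw [← nsmul_eq_mul]
    refine (Finset.card_nsmul_le_sum B _ _ fun v hv => ?_).trans
      (Finset.sum_le_univ_sum_of_nonneg fun a => sq_nonneg _)
    have := hB v hv
    have h0 : 0 ≤ 15 * ε ^ 2 * n := by positivity
    nlinarith
  have hpow : (B.card : ℝ) * (225 * ε ^ 4) ≤ (5 * ε ^ 2 * n) * (225 * ε ^ 4) := by
    have : (B.card : ℝ) * (225 * ε ^ 4) * n ^ 2 ≤ (225 * ε ^ 6 * n) * n ^ 2 := by
      nlinarith [mul_le_mul_of_nonneg_right hnε (sq_nonneg (n : ℝ))]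
    have := le_of_mul_le_mul_right this (by positivity)
    nlinarith [show 0 < ε ^ 6 * n by positivity]
  exact le_of_mul_le_mul_right hpow (by positivity)

/-- Deleting few vertices, among them all vertices of low degree, leaves a 3-colourable graph. -/
theorem colorable_induce_compl {n : ℕ} {G : SimpleGraph (Fin n)} (hG : G.CliqueFree 4) {ε : ℝ}
    (hε : 0 < ε) (hε' : ε < 1 / 13) (hn : 0 < n) (B : Finset (Fin n))
    (hB : ∀ v ∉ B, (2 / 3 - 5 * ε ^ 2) * n ≤ (degC G v : ℝ))
    (hcard : (B.card : ℝ) ≤ 5 * ε ^ 2 * n) :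
    (G.induce {v | v ∉ B}).Colorable 3 := by
  have hn' : (0 : ℝ) < n := by exact_mod_cast hn
  have hε2 : ε ^ 2 < 1 / 169 := by nlinarith
  have hBn : B.card + Fintype.card {v | v ∉ B} = n := by
    have h := Finset.card_add_card_compl B
    rw [Fintype.card_fin] at h
    rw [Fintype.card_of_subtype Bᶜ (by simp), h]
  have hlt : B.card < n := by
    have : (B.card : ℝ) < n := by nlinarith
    exact_mod_cast this
  have : Nonempty {v | v ∉ B} := Fintype.card_pos_iff.1 (by omega)
  refine SimpleGraph.colorable_of_cliqueFree_lt_minDegree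
    (hG.comap ⟨(SimpleGraph.Embedding.induce _).toCopy⟩) ?_
  obtain ⟨⟨v, hv⟩, hmin⟩ := (G.induce {v | v ∉ B}).exists_minimal_degree_vertex
  rw [hmin]
  have hdeg : degC G v ≤ (G.induce {v | v ∉ B}).degree ⟨v, hv⟩ + B.card := by
    rw [← SimpleGraph.card_neighborFinset_eq_degree,
      ← Finset.card_map (Function.Embedding.subtype _)]
    refine (Finset.card_le_card fun w hw => ?_).trans (Finset.card_union_le _ _)
    have hvw : G.Adj v w := by simpa using hw
    by_cases hwB : w ∈ B <;> simp [hwB, hvw]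
  refine (Nat.div_lt_iff_lt_mul (by norm_num)).2 ?_
  have hdeg' : (degC G v : ℝ) ≤ (G.induce {v | v ∉ B}).degree ⟨v, hv⟩ + B.card := by
    exact_mod_cast hdeg
  generalize Fintype.card {v | v ∉ B} = m at hBn ⊢
  have hBn' : (B.card : ℝ) + m = n := by exact_mod_cast hBn
  have hv' := hB v hv
  have hε2n := mul_lt_mul_of_pos_right hε2 hn'
  rw [← Nat.cast_lt (α := ℝ)]
  push_cast
  linarith

end Graph

end GoodmanStmt

/-- For every 0 < ε < 1/13 there is n₂ such that: if `G` is a K₄-free graph on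
`n ≥ n₂` vertices with `Δ̄(G) ≤ 1/9 + ε⁶` and `B` is the set of vertices of
degree less than `(2/3 − 5ε²)·n`, then `|B| ≤ 5ε²·n` and the induced subgraph
on the complement of `B` is 3-partite, i.e. `V \ B` can be partitioned into
three independent sets. -/
theorem stmt_13 (ε : ℝ) (hε : 0 < ε) (hε' : ε < 1 / 13) :
    ∃ n₂ : ℕ, 0 < n₂ ∧ ∀ n : ℕ, n₂ ≤ n → ∀ G : SimpleGraph (Fin n),
      G.CliqueFree 4 →
      indepDens G ≤ 1 / 9 + ε ^ 6 →
      ∀ B : Finset (Fin n),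
        B = Finset.univ.filter
          (fun v => (degC G v : ℝ) < (2 / 3 - 5 * ε ^ 2) * (n : ℝ)) →
        ((B.card : ℝ) ≤ 5 * ε ^ 2 * (n : ℝ) ∧
          ∃ W₀ W₁ W₂ : Finset (Fin n),
            W₀ ∪ W₁ ∪ W₂ = Finset.univ \ B ∧
            Disjoint W₀ W₁ ∧ Disjoint W₀ W₂ ∧ Disjoint W₁ W₂ ∧
            (∀ x ∈ W₀, ∀ y ∈ W₀, ¬ G.Adj x y) ∧
            (∀ x ∈ W₁, ∀ y ∈ W₁, ¬ G.Adj x y) ∧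
            (∀ x ∈ W₂, ∀ y ∈ W₂, ¬ G.Adj x y)) := by
  refine ⟨max 3 ⌈2 / ε ^ 6⌉₊, by positivity, ?_⟩
  rintro n hn G hG hI B rfl
  have hn3 : 3 ≤ n := (le_max_left _ _).trans hn
  have hnε : 2 ≤ ε ^ 6 * n := by
    rw [← div_le_iff₀' (by positivity)]
    exact Nat.ceil_le.1 ((le_max_right _ _).trans hn)
  set B := Finset.univ.filter fun v => (degC G v : ℝ) < (2 / 3 - 5 * ε ^ 2) * (n : ℝ) with hB
  have hcard := card_low_degree_le hG hε hn3 hnε hI B fun v hv => by simpa [hB] using hv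
  refine ⟨hcard, ?_⟩
  obtain ⟨C⟩ := colorable_induce_compl hG hε hε' (by omega) B (fun v hv => by simpa [hB] using hv)
    hcard
  let W : Fin 3 → Finset (Fin n) := fun i => Finset.univ.filter fun v => ∃ h : v ∉ B, C ⟨v, h⟩ = i
  have hdisj : ∀ i j, i ≠ j → Disjoint (W i) (W j) := by
    intro i j hij
    refine Finset.disjoint_left.2 fun v hvi hvj => hij ?_
    obtain ⟨h, rfl⟩ := (Finset.mem_filter.1 hvi).2
    exact (Finset.mem_filter.1 hvj).2.2
  have hindep : ∀ i, ∀ x ∈ W i, ∀ y ∈ W i, ¬ G.Adj x y := by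
    intro i x hx y hy hxy
    obtain ⟨hxB, hxi⟩ := (Finset.mem_filter.1 hx).2
    obtain ⟨hyB, hyi⟩ := (Finset.mem_filter.1 hy).2
    exact C.valid (v := ⟨x, hxB⟩) (w := ⟨y, hyB⟩) hxy (hxi.trans hyi.symm)
  refine ⟨W 0, W 1, W 2, ?_, hdisj _ _ (by decide), hdisj _ _ (by decide), hdisj _ _ (by decide),
    hindep 0, hindep 1, hindep 2⟩
  ext v
  simp only [W, Finset.mem_union, Finset.mem_filter, Finset.mem_univ, true_and,
    Finset.mem_sdiff]
  refine ⟨by rintro ((⟨h, -⟩ | ⟨h, -⟩) | ⟨h, -⟩) <;> exact h, fun h => ?_⟩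
  have key : ∀ i : Fin 3, (i = 0 ∨ i = 1) ∨ i = 2 := by decide
  rcases key (C ⟨v, h⟩) with (h' | h') | h'
  exacts [.inl (.inl ⟨h, h'⟩), .inl (.inr ⟨h, h'⟩), .inr ⟨h, h'⟩]
end

section
/- Let ε > 0, let G be an oriented graph on an n-element vertex set V, let B be the set of vertices v of G with d(v) < (2/3 − 5ε²)·n, and suppose |B| ≤ 5ε²·n and V \ B is the disjoint union of three independent sets V₀, V₁, V₂. Then (1/3 − 15ε²)·n ≤ |V_i| ≤ (1/3 + 5ε²)·n for every i ∈ {0,1,2}. -/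
open scoped Classical

namespace OrientedGraph

variable {V : Type} [Fintype V] [DecidableEq V]

/-- The out-degree of a vertex. -/
noncomputable def outDeg (G : OrientedGraph V) (v : V) : ℕ :=
  (Finset.univ.filter (fun w => G.adj v w)).card

/-- The in-degree of a vertex. -/
noncomputable def inDeg (G : OrientedGraph V) (v : V) : ℕ :=
  (Finset.univ.filter (fun w => G.adj w v)).card

/-- `d(v) = d⁺(v) + d⁻(v)`, the (total) degree of a vertex. -/
noncomputable def deg (G : OrientedGraph V) (v : V) : ℕ :=
  G.outDeg v + G.inDeg v

/-- `d⁺(u,S)`: the number of out-neighbours of `u` in `S`. -/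
noncomputable def outDegIn (G : OrientedGraph V) (u : V) (S : Finset V) : ℕ :=
  (S.filter (fun w => G.adj u w)).card

/-- `d⁻(u,S)`: the number of in-neighbours of `u` in `S`. -/
noncomputable def inDegIn (G : OrientedGraph V) (u : V) (S : Finset V) : ℕ :=
  (S.filter (fun w => G.adj w u)).card

/-- `|E(A,B)|`: the number of edges directed from a vertex of `A` to a vertex
of `B`. -/
noncomputable def eCount (G : OrientedGraph V) (A B : Finset V) : ℕ :=
  ∑ u ∈ A, G.outDegIn u B

end OrientedGraph

/-- A vertex of an independent set `S` has all its neighbours outside `S`. -/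
theorem OrientedGraph.deg_add_card_le {V : Type} [Fintype V] [DecidableEq V]
    (G : OrientedGraph V) {S : Finset V} (hS : ∀ x ∈ S, ∀ y ∈ S, ¬ G.adj x y)
    {v : V} (hv : v ∈ S) : G.deg v + S.card ≤ Fintype.card V := by
  have hdisj : Disjoint (Finset.univ.filter fun w => G.adj v w)
      (Finset.univ.filter fun w => G.adj w v) := by
    rw [Finset.disjoint_filter]
    exact fun w _ h => G.asymm v w h
  have hdisj' : Disjoint ((Finset.univ.filter fun w => G.adj v w) ∪
      (Finset.univ.filter fun w => G.adj w v)) S := by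
    rw [Finset.disjoint_left]
    intro w hw hwS
    simp only [Finset.mem_union, Finset.mem_filter, Finset.mem_univ, true_and] at hw
    exact hw.elim (hS v hv w hwS) (hS w hwS v hv)
  unfold OrientedGraph.deg OrientedGraph.outDeg OrientedGraph.inDeg
  rw [← Finset.card_union_of_disjoint hdisj, ← Finset.card_union_of_disjoint hdisj']
  exact Finset.card_le_univ _

/-- An independent set all of whose vertices have degree at least `(1 - c) n`
has at most `c n` elements. -/
theorem OrientedGraph.card_le_of_isIndep {V : Type} [Fintype V] [DecidableEq V]
    (G : OrientedGraph V) {S : Finset V} (hS : ∀ x ∈ S, ∀ y ∈ S, ¬ G.adj x y)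
    {c : ℝ} (hc : 0 ≤ c)
    (hdeg : ∀ v ∈ S, (1 - c) * (Fintype.card V : ℝ) ≤ (G.deg v : ℝ)) :
    (S.card : ℝ) ≤ c * (Fintype.card V : ℝ) := by
  rcases S.eq_empty_or_nonempty with rfl | ⟨v, hv⟩
  · simpa using mul_nonneg hc (Nat.cast_nonneg _)
  · have h : (G.deg v : ℝ) + S.card ≤ Fintype.card V := by
      exact_mod_cast G.deg_add_card_le hS hv
    linarith [hdeg v hv]

/-- If `B` is the set of vertices of degree `< (2/3 − 5ε²)n`, `|B| ≤ 5ε²n`,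
and the complement of `B` is the disjoint union of three independent sets
`V₀, V₁, V₂`, then `(1/3 − 15ε²)n ≤ |V_i| ≤ (1/3 + 5ε²)n` for each `i`. -/
theorem stmt_14 {n : ℕ} (ε : ℝ) (hε : 0 < ε) (G : OrientedGraph (Fin n))
    (B : Finset (Fin n))
    (hB : B = Finset.univ.filter
      (fun v => (G.deg v : ℝ) < (2 / 3 - 5 * ε ^ 2) * (n : ℝ)))
    (hBcard : (B.card : ℝ) ≤ 5 * ε ^ 2 * (n : ℝ))
    (V₀ V₁ V₂ : Finset (Fin n))
    (hd01 : Disjoint V₀ V₁) (hd02 : Disjoint V₀ V₂) (hd12 : Disjoint V₁ V₂)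
    (hunion : V₀ ∪ V₁ ∪ V₂ = Finset.univ \ B)
    (hind0 : ∀ x ∈ V₀, ∀ y ∈ V₀, ¬ G.adj x y)
    (hind1 : ∀ x ∈ V₁, ∀ y ∈ V₁, ¬ G.adj x y)
    (hind2 : ∀ x ∈ V₂, ∀ y ∈ V₂, ¬ G.adj x y) :
    ((1 / 3 - 15 * ε ^ 2) * (n : ℝ) ≤ (V₀.card : ℝ) ∧
        (V₀.card : ℝ) ≤ (1 / 3 + 5 * ε ^ 2) * (n : ℝ)) ∧
      ((1 / 3 - 15 * ε ^ 2) * (n : ℝ) ≤ (V₁.card : ℝ) ∧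
        (V₁.card : ℝ) ≤ (1 / 3 + 5 * ε ^ 2) * (n : ℝ)) ∧
      ((1 / 3 - 15 * ε ^ 2) * (n : ℝ) ≤ (V₂.card : ℝ) ∧
        (V₂.card : ℝ) ≤ (1 / 3 + 5 * ε ^ 2) * (n : ℝ)) := by
  have hdeg : ∀ v ∈ V₀ ∪ V₁ ∪ V₂,
      (1 - (1 / 3 + 5 * ε ^ 2)) * (Fintype.card (Fin n) : ℝ) ≤ (G.deg v : ℝ) := by
    intro v hv
    simp only [hunion, hB, Finset.mem_sdiff, Finset.mem_filter, Finset.mem_univ, true_and,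
      not_lt] at hv
    rw [Fintype.card_fin]
    linarith
  have hc : 0 ≤ 1 / 3 + 5 * ε ^ 2 := by positivity
  have h0 := G.card_le_of_isIndep hind0 hc fun v hv => hdeg v (by simp [hv])
  have h1 := G.card_le_of_isIndep hind1 hc fun v hv => hdeg v (by simp [hv])
  have h2 := G.card_le_of_isIndep hind2 hc fun v hv => hdeg v (by simp [hv])
  rw [Fintype.card_fin] at h0 h1 h2
  have hcard : (V₀.card : ℝ) + V₁.card + V₂.card + B.card = n := by
    have h := Finset.card_sdiff_add_card_eq_card (Finset.subset_univ B)
    rw [← hunion, Finset.card_union_of_disjoint (Finset.disjoint_union_left.2 ⟨hd02, hd12⟩),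
      Finset.card_union_of_disjoint hd01, Finset.card_univ, Fintype.card_fin] at h
    exact_mod_cast h
  refine ⟨⟨?_, h0⟩, ⟨?_, h1⟩, ⟨?_, h2⟩⟩ <;> linarith
end
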